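/- arXiv:1412.3945 — 2 statements merged into one kernel-verified Lean document; each statement's English description precedes it below -/
import Mathlib

section
/- For all nonnegative integers a, b, c, the number of lozenge tilings of the hexagonal region H_{a,b,c} equals the product over i = 1..a, j = 1..b, k = 1..c of (i+j+k-1)/(i+j+k-2). -/
/-- A unit triangle of the triangular lattice, encoded as `(x, y, ε)` where
`ε = true` means up-pointing and `ε = false` means down-pointing. -/
abbrev Tri : Type := ℤ × ℤ × Bool

/-- Two unit triangles are adjacent (i.e. together they form a lozenge) iff one of them is
the up-triangle at `(x,y)` and the other is one of the down-triangles at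
`(x,y)`, `(x-1,y)`, `(x,y-1)`. -/
def Adj (s t : Tri) : Prop :=
  ∃ x y : ℤ,
    ({s, t} : Set Tri) = {(x, y, true), (x, y, false)} ∨
    ({s, t} : Set Tri) = {(x, y, true), (x - 1, y, false)} ∨
    ({s, t} : Set Tri) = {(x, y, true), (x, y - 1, false)}

/-- `P` is a lozenge tiling of the region `R`: a partition of `R` into pairs of
adjacent unit triangles. -/
def IsLozengeTiling (R : Set Tri) (P : Set (Set Tri)) : Prop :=
  (∀ L ∈ P, ∃ s t : Tri, Adj s t ∧ L = {s, t}) ∧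
  (∀ L ∈ P, L ⊆ R) ∧
  (∀ r ∈ R, ∃! L, L ∈ P ∧ r ∈ L)

/-- The number of lozenge tilings of the region `R`. -/
noncomputable def M (R : Set Tri) : ℕ :=
  Nat.card {P : Set (Set Tri) // IsLozengeTiling R P}

/-- The hexagonal region `H^k_{a,b,c}` on the triangular lattice, whose side lengths in
clockwise order starting from the top side are `a, b+k, c, a+k, b, c+k`.
(Concretely: the unit triangles all of whose vertices `(x,y)` satisfy
`0 ≤ x ≤ a+b+k`, `0 ≤ y ≤ b+c+k`, `b ≤ x+y ≤ a+b+c+k`.) -/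
def HexK (a b c k : ℕ) : Set Tri :=
  {t | 0 ≤ t.1 ∧ t.1 ≤ (a : ℤ) + b + k - 1 ∧ 0 ≤ t.2.1 ∧ t.2.1 ≤ (b : ℤ) + c + k - 1 ∧
    (if t.2.2 then (b : ℤ) ≤ t.1 + t.2.1 ∧ t.1 + t.2.1 ≤ (a : ℤ) + b + c + k - 1
     else (b : ℤ) - 1 ≤ t.1 + t.2.1 ∧ t.1 + t.2.1 ≤ (a : ℤ) + b + c + k - 2)}

/-- The hexagonal region `H_{a,b,c}` whose side lengths in clockwise order starting from
the top side are `a, b, c, a, b, c`. -/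
def Hex (a b c : ℕ) : Set Tri := HexK a b c 0

open Finset

lemma sum_Ioc_descPochhammer (p q : ℤ) (h : p ≤ q) (j : ℕ) :
    ∑ x ∈ Ioc p q, (descPochhammer ℚ j).eval (x : ℚ) =
      ((descPochhammer ℚ (j + 1)).eval ((q : ℚ) + 1) -
        (descPochhammer ℚ (j + 1)).eval ((p : ℚ) + 1)) * ((j : ℚ) + 1)⁻¹ := by
  have hj : (j : ℚ) + 1 ≠ 0 := by positivity
  induction q, h using Int.leInduction with
  | base => simp
  | succ q hq ih =>
    have hs : Ioc p (q + 1) = insert (q + 1) (Ioc p q) := by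
      ext x; simp only [mem_Ioc, mem_insert]; omega
    rw [hs, sum_insert (by simp), ih]
    have h1 : (descPochhammer ℚ (j + 1)).eval ((q : ℚ) + 1 + 1) =
        ((q : ℚ) + 1 + 1) * (descPochhammer ℚ j).eval ((q : ℚ) + 1) := by
      rw [descPochhammer_succ_left]
      simp
    have h2 := descPochhammer_succ_eval j ((q : ℚ) + 1)
    push_cast
    rw [h1, h2]
    field_simp
    ring

/-- Summing the Vandermonde determinant over all integer vectors interlacing with `l`. -/
lemma sum_det_vandermonde_interlacing (n : ℕ) (l : Fin (n + 1) → ℤ) (hl : Monotone l) :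
    (∑ m ∈ Fintype.piFinset (fun i : Fin n => Ioc (l i.castSucc) (l i.succ)),
      (Matrix.vandermonde (fun i => (m i : ℚ))).det) * (n.factorial : ℚ) =
      (Matrix.vandermonde (fun i => (l i : ℚ))).det := by
  have key {k : ℕ} (v : Fin k → ℚ) : (Matrix.vandermonde v).det =
      (Matrix.of fun i j : Fin k => (descPochhammer ℚ j).eval (v i)).det :=
    Matrix.det_eval_matrixOfPolynomials_eq_det_vandermonde v (fun j => descPochhammer ℚ j)
      (fun i => descPochhammer_natDegree ℚ i) (fun i => monic_descPochhammer ℚ i)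
  have hsum : ∑ m ∈ Fintype.piFinset (fun i : Fin n => Ioc (l i.castSucc) (l i.succ)),
      (Matrix.vandermonde (fun i => (m i : ℚ))).det =
      (Matrix.of fun i j : Fin n => ((descPochhammer ℚ (j + 1)).eval ((l i.succ : ℚ) + 1) -
        (descPochhammer ℚ (j + 1)).eval ((l i.castSucc : ℚ) + 1)) * ((j : ℚ) + 1)⁻¹).det := by
    simp_rw [key]
    refine ((Matrix.detRowAlternating (n := Fin n) (R := ℚ)).toMultilinearMap.map_sum_finset
      (fun (i : Fin n) (x : ℤ) (j : Fin n) => (descPochhammer ℚ j).eval (x : ℚ))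
      (fun i : Fin n => Ioc (l i.castSucc) (l i.succ))).symm.trans ?_
    change Matrix.det _ = _
    congr 1
    ext i j
    rw [Finset.sum_apply]
    exact sum_Ioc_descPochhammer _ _ (hl (Fin.castSucc_lt_succ).le) j
  have hfac : ∏ j : Fin n, ((j : ℚ) + 1) = n.factorial := by
    rw [Fin.prod_univ_eq_prod_range (fun j : ℕ => (j : ℚ) + 1), ← prod_range_add_one_eq_factorial]
    push_cast; rfl
  rw [hsum]
  have hcol := Matrix.det_mul_row (fun j : Fin n => ((j : ℚ) + 1)⁻¹)
    (Matrix.of fun i j : Fin n => ((descPochhammer ℚ (j + 1)).eval ((l i.succ : ℚ) + 1) -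
        (descPochhammer ℚ (j + 1)).eval ((l i.castSucc : ℚ) + 1)))
  have hcomm : (Matrix.of fun i j : Fin n => ((descPochhammer ℚ (j + 1)).eval ((l i.succ : ℚ) + 1) -
        (descPochhammer ℚ (j + 1)).eval ((l i.castSucc : ℚ) + 1)) * ((j : ℚ) + 1)⁻¹) =
      Matrix.of fun i j : Fin n => ((j : ℚ) + 1)⁻¹ *
        (Matrix.of fun i j : Fin n => ((descPochhammer ℚ (j + 1)).eval ((l i.succ : ℚ) + 1) -
        (descPochhammer ℚ (j + 1)).eval ((l i.castSucc : ℚ) + 1))) i j := by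
    ext i j; simp [mul_comm]
  rw [hcomm, hcol, prod_inv_distrib, hfac, mul_comm, ← mul_assoc,
    mul_inv_cancel₀ (by positivity), one_mul, ← Matrix.det_vandermonde_add _ (1 : ℚ), key]
  rw [Matrix.det_eq_of_forall_row_eq_smul_add_pred (B := Matrix.of fun i j : Fin (n + 1) =>
    Fin.cases ((descPochhammer ℚ j).eval ((l 0 : ℚ) + 1))
      (fun k : Fin n => (descPochhammer ℚ j).eval ((l k.succ : ℚ) + 1) -
        (descPochhammer ℚ j).eval ((l k.castSucc : ℚ) + 1)) i) (fun _ => 1)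
    (by intro j; simp) (by intro i j; simp)]
  rw [Matrix.det_succ_column_zero, Fin.sum_univ_succ]
  simp only [Matrix.of_apply, Fin.cases_zero, Fin.cases_succ, Fin.val_zero, descPochhammer_zero,
    Polynomial.eval_one, sub_self, mul_zero, zero_mul, sum_const_zero, add_zero, pow_zero, one_mul,
    Fin.succAbove_zero]
  congr 1

lemma det_vandermonde_eq_prod_range (f : ℕ → ℚ) (n : ℕ) :
    (Matrix.vandermonde (fun i : Fin n => f i)).det =
      ∏ j ∈ range n, ∏ i ∈ range j, (f j - f i) := by
  have h : ∏ i : Fin n, ∏ j ∈ Ioi i, (f j - f i) = ∏ j : Fin n, ∏ i ∈ Iio j, (f j - f i) :=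
    prod_comm' (by simp)
  rw [Matrix.det_vandermonde, h, ← Fin.prod_univ_eq_prod_range (fun j => ∏ i ∈ range j, (f j - f i))]
  refine prod_congr rfl fun j _ => ?_
  rw [← Nat.Iio_eq_range, ← Fin.map_valEmbedding_Iio, prod_map]
  rfl

lemma prod_range_sub_cast_eq_factorial (n : ℕ) :
    ∏ i ∈ range n, ((n : ℚ) - i) = n.factorial := by
  rw [← prod_range_add_one_eq_factorial, ← prod_range_reflect, Nat.cast_prod]
  refine prod_congr rfl fun i hi => ?_
  have := mem_range.1 hi
  rw [Nat.cast_add, Nat.sub_sub, Nat.cast_sub (by omega)]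
  push_cast; ring

lemma prod_Icc_div_telescope (a : ℕ) (t : ℚ) (ht : 0 < t) :
    ∏ i ∈ Icc 1 a, ((i : ℚ) + t) / ((i : ℚ) + t - 1) = (a + t) / t := by
  induction a with
  | zero => simp [ht.ne']
  | succ a ih =>
    rw [prod_Icc_succ_top (by omega), ih]
    have : (a : ℚ) + t ≠ 0 := by positivity
    push_cast
    rw [show (a : ℚ) + 1 + t - 1 = a + t by ring]
    field_simp

lemma vandermonde_two_blocks (a b c : ℕ) :
    (Matrix.vandermonde (fun i : Fin (c + b) =>
        (((if (i : ℕ) < c then (i : ℤ) - c else a + i - c : ℤ)) : ℚ))).det =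
      (∏ i ∈ Icc 1 a, ∏ j ∈ Icc 1 b, ∏ k ∈ Icc 1 c,
        ((i : ℚ) + j + k - 1) / ((i : ℚ) + j + k - 2)) *
      ∏ j ∈ range (c + b), (j.factorial : ℚ) := by
  rw [det_vandermonde_eq_prod_range
    (fun i : ℕ => (((if i < c then (i : ℤ) - c else a + i - c : ℤ)) : ℚ))]
  induction b with
  | zero =>
    simp only [add_zero, Icc_eq_empty_of_lt zero_lt_one, prod_empty, prod_const_one, one_mul]
    refine prod_congr rfl fun j hj => ?_
    have := mem_range.1 hj
    rw [← prod_range_sub_cast_eq_factorial]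
    refine prod_congr rfl fun i hi => ?_
    have := mem_range.1 hi
    rw [if_pos (by omega), if_pos (by omega)]
    push_cast; ring
  | succ b ih =>
    rw [← add_assoc, prod_range_succ, prod_range_succ _ (c + b), ih]
    have h1 : ∏ i ∈ range (c + b), (((if c + b < c then ((c + b : ℕ) : ℤ) - c else
        a + ((c + b : ℕ) : ℤ) - c : ℤ) : ℚ) - ((if i < c then (i : ℤ) - c else a + i - c : ℤ) : ℚ)) =
        (∏ k ∈ Icc 1 c, ((a : ℚ) + b + k)) * b.factorial := by
      rw [prod_range_add]
      congr 1
      · refine prod_nbij' (fun i => c - i) (fun k => c - k) ?_ ?_ ?_ ?_ fun i hi => ?_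
        iterate 4 simp only [mem_range, mem_Icc]; omega
        have := mem_range.1 hi
        rw [if_neg (by omega), if_pos (by omega), Nat.cast_sub (by omega)]
        push_cast; ring
      · rw [← prod_range_sub_cast_eq_factorial]
        refine prod_congr rfl fun i hi => ?_
        rw [if_neg (by omega), if_neg (by omega)]
        push_cast; ring
    have h2 : ((c + b).factorial : ℚ) = (∏ k ∈ Icc 1 c, ((b : ℚ) + k)) * b.factorial := by
      clear h1 ih
      induction c with
      | zero => simp
      | succ c ih =>
        rw [prod_Icc_succ_top (by omega), mul_right_comm, ← ih, add_right_comm, Nat.factorial_succ]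
        push_cast; ring
    have h3 : ∏ i ∈ Icc 1 a, ∏ j ∈ Icc 1 (b + 1), ∏ k ∈ Icc 1 c,
        ((i : ℚ) + j + k - 1) / ((i : ℚ) + j + k - 2) =
        (∏ i ∈ Icc 1 a, ∏ j ∈ Icc 1 b, ∏ k ∈ Icc 1 c,
          ((i : ℚ) + j + k - 1) / ((i : ℚ) + j + k - 2)) *
        ∏ k ∈ Icc 1 c, (((a : ℚ) + b + k) / (b + k)) := by
      simp_rw [prod_Icc_succ_top (Nat.le_add_left 1 b), prod_mul_distrib]
      congr 1
      rw [prod_comm]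
      refine prod_congr rfl fun k hk => ?_
      have hk1 : (1 : ℚ) ≤ k := by exact_mod_cast (mem_Icc.1 hk).1
      rw [add_assoc (a : ℚ), ← prod_Icc_div_telescope a _ (by positivity)]
      refine prod_congr rfl fun i _ => ?_
      push_cast
      congr 1 <;> ring
    have h4 : ∏ k ∈ Icc 1 c, ((b : ℚ) + k) ≠ 0 := prod_ne_zero_iff.2 fun k hk => by
      have hk1 : (1 : ℚ) ≤ k := by exact_mod_cast (mem_Icc.1 hk).1
      positivity
    rw [h1, h2, h3, prod_div_distrib]
    field_simp

/-- Height functions of lozenge tilings of the strip `0 ≤ y ≤ n` which vanish on the bottom line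
and equal `T` on the top line. -/
structure IsHeight (n : ℕ) (T : ℤ → ℤ) (H : ℕ → ℤ → ℤ) : Prop where
  bot : H 0 = 0
  top : H n = T
  above : ∀ y, n < y → H y = 0
  mono : ∀ y < n, ∀ x, H y x ≤ H y (x + 1)
  shift : ∀ y < n, ∀ x, H y (x + 1) ≤ H (y + 1) x
  step : ∀ y < n, ∀ x, H (y + 1) x ≤ H y x + 1

lemma IsHeight.nonneg {n : ℕ} {T : ℤ → ℤ} {H : ℕ → ℤ → ℤ} (h : IsHeight n T H) (y : ℕ)
    (hy : y ≤ n) (x : ℤ) : 0 ≤ H y x := by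
  induction y generalizing x with
  | zero => simp [h.bot]
  | succ y ih => exact (ih (by omega) _).trans (h.shift y (by omega) x)

lemma IsHeight.le_row {n : ℕ} {T : ℤ → ℤ} {H : ℕ → ℤ → ℤ} (h : IsHeight n T H) (y : ℕ)
    (hy : y ≤ n) (x : ℤ) : H y x ≤ y := by
  induction y generalizing x with
  | zero => simp [h.bot]
  | succ y ih =>
    have := ih (by omega) x
    have := h.step y (by omega) x
    push_cast
    omega

lemma IsHeight.le_top {n : ℕ} {T : ℤ → ℤ} {H : ℕ → ℤ → ℤ} (h : IsHeight n T H) (k y : ℕ)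
    (hy : y + k = n) (x : ℤ) : H y x ≤ T (x - k) := by
  induction k generalizing x y with
  | zero => rw [← h.top, ← hy]; simp
  | succ k ih =>
    have h1 := ih (y + 1) (by omega) (x - 1)
    have h2 := h.shift y (by omega) (x - 1)
    rw [sub_add_cancel] at h2
    rw [show x - ((k + 1 : ℕ) : ℤ) = x - 1 - k by push_cast; ring]
    omega

lemma IsHeight.top_le {n : ℕ} {T : ℤ → ℤ} {H : ℕ → ℤ → ℤ} (h : IsHeight n T H) (k y : ℕ)
    (hy : y + k = n) (x : ℤ) : T x ≤ H y x + k := by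
  induction k generalizing y with
  | zero => rw [← h.top, ← hy]; simp
  | succ k ih =>
    have h1 := ih (y + 1) (by omega)
    have h2 := h.step y (by omega) x
    push_cast
    omega

/-- `h` is the function counting the values of `l` below a given integer. -/
structure IsCounting {n : ℕ} (l : Fin n → ℤ) (h : ℤ → ℤ) : Prop where
  nonneg : ∀ x, 0 ≤ h x
  le : ∀ x, h x ≤ n
  lt_iff : ∀ x i, l i < x ↔ ((i : ℕ) : ℤ) < h x

lemma IsCounting.function_unique {n : ℕ} {l : Fin n → ℤ} {g h : ℤ → ℤ} (hg : IsCounting l g)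
    (hh : IsCounting l h) : g = h := by
  have aux {g h : ℤ → ℤ} (hg : IsCounting l g) (hh : IsCounting l h) (x : ℤ) : g x ≤ h x := by
    by_contra! hlt
    have h0 := hh.nonneg x
    have h1 := hg.le x
    have h2 := hg.lt_iff x ⟨(h x).toNat, by omega⟩
    have h3 := hh.lt_iff x ⟨(h x).toNat, by omega⟩
    simp only [Int.toNat_of_nonneg h0] at h2 h3
    exact lt_irrefl _ (h3.1 (h2.2 hlt))
  exact funext fun x => le_antisymm (aux hg hh x) (aux hh hg x)

lemma IsCounting.vector_unique {n : ℕ} {l m : Fin n → ℤ} {h : ℤ → ℤ} (hl : IsCounting l h)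
    (hm : IsCounting m h) : l = m := by
  funext i
  have h1 := (hm.lt_iff (l i + 1) i).2 ((hl.lt_iff (l i + 1) i).1 (by omega))
  have h2 := (hl.lt_iff (m i + 1) i).2 ((hm.lt_iff (m i + 1) i).1 (by omega))
  omega

lemma exists_isCounting {n : ℕ} (l : Fin n → ℤ) (hl : Monotone l) : ∃ h, IsCounting l h := by
  refine ⟨fun x => (#{i | l i < x} : ℕ), fun x => by positivity, fun x => ?_, fun x i => ?_⟩
  · have := card_filter_le (univ : Finset (Fin n)) (fun i => l i < x)
    rw [card_univ, Fintype.card_fin] at this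
    exact_mod_cast this
  · rw [Nat.cast_lt]
    constructor
    · intro hi
      have : Iic i ⊆ ({i | l i < x} : Finset (Fin n)) := fun j hj => by
        simpa using (hl (mem_Iic.1 hj)).trans_lt hi
      have := card_le_card this
      rw [Fin.card_Iic] at this
      omega
    · contrapose!
      intro hi
      have : ({i | l i < x} : Finset (Fin n)) ⊆ Iio i := fun j hj => by
        rw [mem_Iio]
        by_contra! hij
        have := hl hij
        have := (mem_filter.1 hj).2
        omega
      have := card_le_card this
      rwa [Fin.card_Iio] at this

/-- A function interlacing with a counting function of `n + 1` values counts `n` values. -/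
lemma exists_isCounting_of_interlacing {n : ℕ} {l : Fin (n + 1) → ℤ} {h' h : ℤ → ℤ}
    (hl : IsCounting l h') (h0 : ∀ x, 0 ≤ h x) (hn : ∀ x, h x ≤ n) (hm : ∀ x, h x ≤ h (x + 1))
    (hs : ∀ x, h (x + 1) ≤ h' x) (ht : ∀ x, h' x ≤ h x + 1) :
    ∃ m : Fin n → ℤ, (∀ i, m i ∈ Ioc (l i.castSucc) (l i.succ)) ∧ IsCounting m h := by
  have hmono : Monotone h := monotone_int_of_le_succ hm
  have hex (i : Fin n) : ∃ z : ℤ, ∀ x, z < x ↔ ((i : ℕ) : ℤ) < h x := by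
    have hle : h (l i.castSucc + 1) ≤ ((i : ℕ) : ℤ) := by
      have h1 := hs (l i.castSucc)
      have h2 := (hl.lt_iff (l i.castSucc) i.castSucc).not.1 (lt_irrefl _)
      simp only [Fin.val_castSucc] at h2
      omega
    have hgt : ((i : ℕ) : ℤ) < h (l i.succ + 1) := by
      have h1 := ht (l i.succ + 1)
      have h2 := (hl.lt_iff (l i.succ + 1) i.succ).1 (by omega)
      simp only [Fin.val_succ] at h2
      push_cast at h2
      omega
    obtain ⟨z, hz, hz'⟩ := Int.exists_greatest_of_bdd (P := fun x => h x ≤ ((i : ℕ) : ℤ))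
      ⟨l i.succ + 1, fun z hz => by
        by_contra! hlt
        have := hmono hlt.le
        omega⟩ ⟨_, hle⟩
    refine ⟨z, fun x => ⟨fun hx => ?_, fun hx => ?_⟩⟩
    · by_contra! hc
      have := hz' x hc
      omega
    · by_contra! hc
      have := hmono hc
      omega
  choose m hmz using hex
  refine ⟨m, fun i => mem_Ioc.2 ⟨?_, ?_⟩, h0, hn, fun x i => hmz i x⟩
  · have h1 := (hmz i (m i + 1)).1 (by omega)
    exact (hl.lt_iff _ i.castSucc).2 (by have := hs (m i); simp only [Fin.val_castSucc]; omega)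
  · by_contra! hc
    have h1 := (hl.lt_iff _ i.succ).1 hc
    have h2 := ht (m i)
    have h3 := (hmz i (m i)).not.1 (lt_irrefl _)
    simp only [Fin.val_succ] at h1
    push_cast at h1
    omega

lemma IsCounting.mono {n : ℕ} {m : Fin n → ℤ} {h : ℤ → ℤ} (hm : IsCounting m h) (x : ℤ) :
    h x ≤ h (x + 1) := by
  by_contra! hlt
  have h0 := hm.nonneg (x + 1)
  have h1 := hm.le x
  have h2 := hm.lt_iff x ⟨(h (x + 1)).toNat, by omega⟩
  have h3 := hm.lt_iff (x + 1) ⟨(h (x + 1)).toNat, by omega⟩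
  simp only [Int.toNat_of_nonneg h0] at h2 h3
  omega

lemma IsCounting.shift {n : ℕ} {l : Fin (n + 1) → ℤ} {m : Fin n → ℤ} {h' h : ℤ → ℤ}
    (hl : IsCounting l h') (hm : IsCounting m h)
    (hlm : ∀ i, m i ∈ Ioc (l i.castSucc) (l i.succ)) (x : ℤ) : h (x + 1) ≤ h' x := by
  by_contra! hlt
  have h0 := hl.nonneg x
  have h1 := hm.le (x + 1)
  let i : Fin n := ⟨(h' x).toNat, by omega⟩
  have h2 := hm.lt_iff (x + 1) i
  have h3 := hl.lt_iff x i.castSucc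
  have h4 := mem_Ioc.1 (hlm i)
  simp only [Fin.val_castSucc, i, Int.toNat_of_nonneg h0] at h2 h3 h4
  omega

lemma IsCounting.step {n : ℕ} {l : Fin (n + 1) → ℤ} {m : Fin n → ℤ} {h' h : ℤ → ℤ}
    (hl : IsCounting l h') (hm : IsCounting m h)
    (hlm : ∀ i, m i ∈ Ioc (l i.castSucc) (l i.succ)) (x : ℤ) : h' x ≤ h x + 1 := by
  by_contra! hlt
  have h0 := hm.nonneg x
  have h1 := hl.le x
  push_cast at h1
  let i : Fin n := ⟨(h x).toNat, by omega⟩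
  have h2 := hm.lt_iff x i
  have h3 := hl.lt_iff x i.succ
  have h4 := mem_Ioc.1 (hlm i)
  simp only [Fin.val_succ, i, Nat.cast_add, Nat.cast_one, Int.toNat_of_nonneg h0] at h2 h3 h4
  omega

/-- Appending a row at the top of a height function. -/
lemma IsHeight.update {n : ℕ} {T T' : ℤ → ℤ} {H : ℕ → ℤ → ℤ} (h : IsHeight n T H)
    (hm : ∀ x, T x ≤ T (x + 1)) (hs : ∀ x, T (x + 1) ≤ T' x) (ht : ∀ x, T' x ≤ T x + 1) :
    IsHeight (n + 1) T' (Function.update H (n + 1) T') := by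
  have hne {y : ℕ} (hy : y ≠ n + 1) : Function.update H (n + 1) T' y = H y :=
    Function.update_of_ne hy _ _
  refine ⟨by rw [hne (by omega), h.bot], by simp, fun y hy => ?_, fun y hy x => ?_,
    fun y hy x => ?_, fun y hy x => ?_⟩
  · rw [hne (by omega), h.above y (by omega)]
  · rw [hne (by omega)]
    obtain hy | rfl := Nat.lt_succ_iff_lt_or_eq.1 hy
    · exact h.mono y hy x
    · rw [h.top]; exact hm x
  · rw [hne (by omega)]
    obtain hy | rfl := Nat.lt_succ_iff_lt_or_eq.1 hy
    · rw [hne (by omega)]; exact h.shift y hy x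
    · rw [h.top, Function.update_self]; exact hs x
  · rw [hne hy.ne]
    obtain hy | rfl := Nat.lt_succ_iff_lt_or_eq.1 hy
    · rw [hne (by omega)]; exact h.step y hy x
    · rw [h.top, Function.update_self]; exact ht x

/-- Removing the top row of a height function. -/
lemma IsHeight.restrict {n : ℕ} {T : ℤ → ℤ} {H : ℕ → ℤ → ℤ} (h : IsHeight (n + 1) T H) :
    IsHeight n (H n) (Function.update H (n + 1) 0) := by
  have hne {y : ℕ} (hy : y ≠ n + 1) : Function.update H (n + 1) 0 y = H y :=
    Function.update_of_ne hy _ _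
  refine ⟨by rw [hne (by omega), h.bot], hne (by omega), fun y hy => ?_, fun y hy x => ?_,
    fun y hy x => ?_, fun y hy x => ?_⟩
  · obtain rfl | hy' := eq_or_ne y (n + 1)
    · simp
    · rw [hne hy', h.above y (by omega)]
  · rw [hne (by omega)]; exact h.mono y (by omega) x
  · rw [hne (by omega), hne (by omega)]; exact h.shift y (by omega) x
  · rw [hne (by omega), hne (by omega)]; exact h.step y (by omega) x

/-- The number of height functions of a strip whose top line counts the values of `l` is the
Vandermonde determinant of `l` divided by a superfactorial. -/
theorem card_isHeight (n : ℕ) (l : Fin n → ℤ) (hl : StrictMono l) (T : ℤ → ℤ)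
    (hT : IsCounting l T) :
    Finite {H // IsHeight n T H} ∧
      (Nat.card {H // IsHeight n T H} : ℚ) * ∏ j ∈ range n, (j.factorial : ℚ) =
        (Matrix.vandermonde (fun i => (l i : ℚ))).det := by
  induction n generalizing T with
  | zero =>
    have hT0 : T = 0 := funext fun x => le_antisymm (by simpa using hT.le x) (hT.nonneg x)
    subst hT0
    have : Unique {H // IsHeight 0 0 H} :=
      { default := ⟨0, by constructor <;> simp⟩
        uniq := fun H => Subtype.ext <| funext fun y => by
          obtain rfl | hy := Nat.eq_zero_or_pos y
          · exact H.2.bot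
          · exact H.2.above y hy }
    exact ⟨inferInstance, by simp⟩
  | succ n ih =>
    set box := Fintype.piFinset (fun i : Fin n => Ioc (l i.castSucc) (l i.succ)) with hbox
    have hmem {m : Fin n → ℤ} (hm : m ∈ box) (i : Fin n) : m i ∈ Ioc (l i.castSucc) (l i.succ) :=
      Fintype.mem_piFinset.1 hm i
    have hmono (m : box) : StrictMono m.1 := fun i j hij => by
      have h1 := mem_Ioc.1 (hmem m.2 i)
      have h2 := mem_Ioc.1 (hmem m.2 j)
      have h3 : l i.succ ≤ l j.castSucc := hl.monotone (Fin.succ_le_castSucc_iff.2 hij)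
      omega
    choose S hS using fun m : box => exists_isCounting m.1 (hmono m).monotone
    let F : (Σ m : box, {H // IsHeight n (S m) H}) → {H // IsHeight (n + 1) T H} := fun p =>
      ⟨Function.update p.2.1 (n + 1) T, p.2.2.update (hS p.1).mono
        (hT.shift (hS p.1) (hmem p.1.2)) (hT.step (hS p.1) (hmem p.1.2))⟩
    have hF : Function.Bijective F := by
      constructor
      · rintro ⟨m, H, hH⟩ ⟨m', H', hH'⟩ heq
        have heq : Function.update H (n + 1) T = Function.update H' (n + 1) T :=
          congrArg Subtype.val heq
        have hHH : H = H' := by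
          funext y
          obtain rfl | hy := eq_or_ne y (n + 1)
          · rw [hH.above _ (by omega), hH'.above _ (by omega)]
          · simpa [Function.update_of_ne hy] using congrFun heq y
        subst hHH
        have hmm : m = m' := Subtype.ext <| (hS m).vector_unique <| by
          rw [← hH.top, hH'.top]; exact hS m'
        subst hmm
        rfl
      · rintro ⟨H, hH⟩
        obtain ⟨m, hm, hmc⟩ := exists_isCounting_of_interlacing (h := H n) hT
          (hH.nonneg n (by omega)) (hH.le_row n (by omega)) (hH.mono n (by omega))
          (by rw [← hH.top]; exact hH.shift n (by omega))
          (by rw [← hH.top]; exact hH.step n (by omega))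
        have hmb : m ∈ box := Fintype.mem_piFinset.2 hm
        have hSm : H n = S ⟨m, hmb⟩ := hmc.function_unique (hS ⟨m, hmb⟩)
        refine ⟨⟨⟨m, hmb⟩, Function.update H (n + 1) 0, hSm ▸ hH.restrict⟩, Subtype.ext ?_⟩
        simp only [F, Function.update_idem]
        rw [← hH.top, Function.update_eq_self]
    have hfin (m : box) := (ih m.1 (hmono m) (S m) (hS m)).1
    refine ⟨Finite.of_surjective F hF.2, ?_⟩
    rw [← Nat.card_eq_of_bijective F hF, Nat.card_sigma, prod_range_succ, ← mul_assoc,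
      Nat.cast_sum, sum_mul, sum_congr rfl fun m _ => (ih m.1 (hmono m) (S m) (hS m)).2,
      ← sum_det_vandermonde_interlacing n l hl.monotone,
      sum_coe_sort box (fun m => (Matrix.vandermonde (fun i => (m i : ℚ))).det)]

/-- The down-triangle covered by the lozenge in direction `k` whose up-triangle is at `(x, y)`. -/
def downNeighbor : Fin 3 → ℤ → ℤ → Tri
  | 0, x, y => (x, y, false)
  | 1, x, y => (x - 1, y, false)
  | 2, x, y => (x, y - 1, false)

/-- The lozenge in direction `k` whose up-triangle is at `(x, y)`. -/
def lozenge (k : Fin 3) (x y : ℤ) : Set Tri := {(x, y, true), downNeighbor k x y}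

lemma up_mem_lozenge {k : Fin 3} {x y x' y' : ℤ} :
    (x', y', true) ∈ lozenge k x y ↔ x' = x ∧ y' = y := by
  fin_cases k <;> simp [lozenge, downNeighbor]

lemma down_mem_lozenge {k : Fin 3} {x y x' y' : ℤ} :
    (x', y', false) ∈ lozenge k x y ↔ downNeighbor k x y = (x', y', false) := by
  fin_cases k <;> simp [lozenge, downNeighbor, eq_comm]

lemma lozenge_inj {k k' : Fin 3} {x y x' y' : ℤ} :
    lozenge k x y = lozenge k' x' y' ↔ k = k' ∧ x = x' ∧ y = y' := by
  refine ⟨fun h => ?_, by rintro ⟨rfl, rfl, rfl⟩; rfl⟩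
  obtain ⟨rfl, rfl⟩ := up_mem_lozenge.1 (h ▸ up_mem_lozenge.2 ⟨rfl, rfl⟩ :
    (x, y, true) ∈ lozenge k' x' y')
  have h2 : downNeighbor k x y ∈ lozenge k' x y := h ▸ Or.inr rfl
  refine ⟨?_, rfl, rfl⟩
  fin_cases k <;> fin_cases k' <;> simp [lozenge, downNeighbor] at h2 ⊢ <;> omega

lemma exists_adj_iff_exists_lozenge (L : Set Tri) :
    (∃ s t, Adj s t ∧ L = {s, t}) ↔ ∃ k x y, L = lozenge k x y := by
  constructor
  · rintro ⟨s, t, ⟨x, y, h | h | h⟩, rfl⟩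
    · exact ⟨0, x, y, h⟩
    · exact ⟨1, x, y, h⟩
    · exact ⟨2, x, y, h⟩
  · rintro ⟨k, x, y, rfl⟩
    refine ⟨_, _, ⟨x, y, ?_⟩, rfl⟩
    fin_cases k <;> simp [downNeighbor]

/-- `E k x y` says that the lozenge in direction `k` with up-triangle `(x, y)` is used in a tiling
of the region `R`. -/
structure IsMatching (R : Set Tri) (E : Fin 3 → ℤ → ℤ → Prop) : Prop where
  mem : ∀ k x y, E k x y → (x, y, true) ∈ R ∧ downNeighbor k x y ∈ R
  up : ∀ x y, (x, y, true) ∈ R → ∃! k, E k x y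
  down : ∀ x y, (x, y, false) ∈ R →
    ∃! p : Fin 3 × ℤ × ℤ, E p.1 p.2.1 p.2.2 ∧ downNeighbor p.1 p.2.1 p.2.2 = (x, y, false)

lemma IsLozengeTiling.isMatching {R : Set Tri} {P : Set (Set Tri)} (h : IsLozengeTiling R P) :
    IsMatching R (fun k x y => lozenge k x y ∈ P) := by
  obtain ⟨h1, h2, h3⟩ := h
  refine ⟨fun k x y hk => ⟨h2 _ hk (Or.inl rfl), h2 _ hk (Or.inr rfl)⟩, fun x y hxy => ?_,
    fun x y hxy => ?_⟩
  · obtain ⟨L, ⟨hL, hr⟩, huniq⟩ := h3 _ hxy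
    obtain ⟨k, x', y', rfl⟩ := (exists_adj_iff_exists_lozenge L).1 (h1 L hL)
    obtain ⟨rfl, rfl⟩ := up_mem_lozenge.1 hr
    exact ⟨k, hL, fun k' hk' => (lozenge_inj.1 (huniq _ ⟨hk', up_mem_lozenge.2 ⟨rfl, rfl⟩⟩)).1⟩
  · obtain ⟨L, ⟨hL, hr⟩, huniq⟩ := h3 _ hxy
    obtain ⟨k, x', y', rfl⟩ := (exists_adj_iff_exists_lozenge L).1 (h1 L hL)
    refine ⟨(k, x', y'), ⟨hL, down_mem_lozenge.1 hr⟩, ?_⟩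
    rintro ⟨k', x'', y''⟩ ⟨hk', hd⟩
    obtain ⟨rfl, rfl, rfl⟩ := lozenge_inj.1 (huniq _ ⟨hk', down_mem_lozenge.2 hd⟩)
    rfl

lemma IsMatching.isLozengeTiling {R : Set Tri} {E : Fin 3 → ℤ → ℤ → Prop} (h : IsMatching R E) :
    IsLozengeTiling R {L | ∃ k x y, E k x y ∧ L = lozenge k x y} := by
  refine ⟨?_, ?_, ?_⟩
  · rintro L ⟨k, x, y, -, rfl⟩
    exact (exists_adj_iff_exists_lozenge _).2 ⟨k, x, y, rfl⟩
  · rintro L ⟨k, x, y, hE, rfl⟩ r (rfl | rfl)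
    exacts [(h.mem k x y hE).1, (h.mem k x y hE).2]
  · rintro ⟨x, y, _ | _⟩ hr
    · obtain ⟨⟨k, x', y'⟩, ⟨hE, hd⟩, huniq⟩ := h.down x y hr
      refine ⟨lozenge k x' y', ⟨⟨k, x', y', hE, rfl⟩, down_mem_lozenge.2 hd⟩, ?_⟩
      rintro _ ⟨⟨k', x'', y'', hE', rfl⟩, hd'⟩
      have := huniq (k', x'', y'') ⟨hE', down_mem_lozenge.1 hd'⟩
      simp only [Prod.mk.injEq] at this
      exact lozenge_inj.2 this
    · obtain ⟨k, hE, huniq⟩ := h.up x y hr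
      refine ⟨lozenge k x y, ⟨⟨k, x, y, hE, rfl⟩, up_mem_lozenge.2 ⟨rfl, rfl⟩⟩, ?_⟩
      rintro _ ⟨⟨k', x', y', hE', rfl⟩, hd'⟩
      obtain ⟨rfl, rfl⟩ := up_mem_lozenge.1 hd'
      rw [huniq k' hE']

lemma M_eq_card_isMatching (R : Set Tri) : M R = Nat.card {E // IsMatching R E} :=
  Nat.card_congr
    { toFun := fun P => ⟨fun k x y => lozenge k x y ∈ P.1, P.2.isMatching⟩
      invFun := fun E => ⟨_, E.2.isLozengeTiling⟩
      left_inv := by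
        rintro ⟨P, hP⟩
        ext L
        constructor
        · rintro ⟨k, x, y, h, rfl⟩
          exact h
        · intro hL
          obtain ⟨k, x, y, rfl⟩ := (exists_adj_iff_exists_lozenge L).1 (hP.1 L hL)
          exact ⟨k, x, y, hL, rfl⟩
      right_inv := by
        rintro ⟨E, hE⟩
        ext k x y
        constructor
        · rintro ⟨k', x', y', h, heq⟩
          obtain ⟨rfl, rfl, rfl⟩ := lozenge_inj.1 heq
          exact h
        · exact fun h => ⟨k, x, y, h, rfl⟩ }

lemma existsUnique_fin_three (p : Fin 3 → Prop) :
    (∃! k, p k) ↔ (p 0 ∧ ¬ p 1 ∧ ¬ p 2) ∨ (¬ p 0 ∧ p 1 ∧ ¬ p 2) ∨ (¬ p 0 ∧ ¬ p 1 ∧ p 2) := by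
  simp only [ExistsUnique, Fin.exists_fin_succ, Fin.forall_fin_succ]
  simp
  tauto

lemma existsUnique_downNeighbor (E : Fin 3 → ℤ → ℤ → Prop) (x y : ℤ) :
    (∃! p : Fin 3 × ℤ × ℤ, E p.1 p.2.1 p.2.2 ∧
      downNeighbor p.1 p.2.1 p.2.2 = (x, y, false)) ↔
    ∃! k, (![E 0 x y, E 1 (x + 1) y, E 2 x (y + 1)] : Fin 3 → Prop) k := by
  have hiff (p : Fin 3 × ℤ × ℤ) : (E p.1 p.2.1 p.2.2 ∧
      downNeighbor p.1 p.2.1 p.2.2 = (x, y, false)) ↔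
      (![E 0 x y, E 1 (x + 1) y, E 2 x (y + 1)] : Fin 3 → Prop) p.1 ∧
        p.2 = (![(x, y), (x + 1, y), (x, y + 1)] : Fin 3 → ℤ × ℤ) p.1 := by
    obtain ⟨k, u, v⟩ := p
    fin_cases k <;> simp [downNeighbor, sub_eq_iff_eq_add]
    all_goals
      rintro rfl rfl
      rfl
  simp_rw [hiff]
  constructor
  · rintro ⟨⟨k, q⟩, ⟨hk, hq⟩, huniq⟩
    exact ⟨k, hk, fun k' hk' => congrArg Prod.fst (huniq (k', _) ⟨hk', rfl⟩)⟩
  · rintro ⟨k, hk, huniq⟩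
    refine ⟨(k, _), ⟨hk, rfl⟩, ?_⟩
    rintro ⟨k', q⟩ ⟨hk', hq⟩
    obtain rfl := huniq k' hk'
    exact Prod.ext rfl hq

lemma up_mem_Hex {a b c : ℕ} {x y : ℤ} : (x, y, true) ∈ Hex a b c ↔
    0 ≤ x ∧ x < a + b ∧ 0 ≤ y ∧ y < b + c ∧ b ≤ x + y ∧ x + y < a + b + c := by
  simp only [Hex, HexK, Set.mem_ofPred_eq, if_true]
  omega

lemma down_mem_Hex {a b c : ℕ} {x y : ℤ} : (x, y, false) ∈ Hex a b c ↔
    0 ≤ x ∧ x < a + b ∧ 0 ≤ y ∧ y < b + c ∧ b ≤ x + y + 1 ∧ x + y + 1 < a + b + c := by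
  simp only [Hex, HexK, Set.mem_ofPred_eq, Bool.false_eq_true, if_false]
  omega

/-- The values of the height functions of `Hex a b c`, extended to the strip
`0 ≤ y ≤ b + c`, on the line `y = b + c`. -/
def hexTop (a b c : ℕ) (x : ℤ) : ℤ := max 0 (min (c : ℤ) (x + c)) + max 0 (min (b : ℤ) (x - a))

lemma isCounting_hexTop (a b c : ℕ) :
    IsCounting (fun i : Fin (c + b) => if (i : ℕ) < c then ((i : ℕ) : ℤ) - c else a + (i : ℕ) - c)
      (hexTop a b c) := by
  refine ⟨fun x => ?_, fun x => ?_, fun x i => ?_⟩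
  · unfold hexTop; omega
  · unfold hexTop; push_cast; omega
  · have := i.2
    unfold hexTop
    split_ifs <;> omega

/-- The indicator of the lozenge in direction `k` with up-triangle `(x, y)` in the tiling with
height function `H`. -/
def heightDiff (H : ℕ → ℤ → ℤ) (k : Fin 3) (x : ℤ) (y : ℕ) : ℤ :=
  match k with
  | 0 => H (y + 1) x - H y (x + 1)
  | 1 => 1 - (H (y + 1) x - H y x)
  | 2 => H y (x + 1) - H y x

section

variable {a b c : ℕ} {H : ℕ → ℤ → ℤ}

lemma IsHeight.eq_left_zero (h : IsHeight (c + b) (hexTop a b c) H) {y : ℕ} (hy : y ≤ c + b)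
    {x : ℤ} (hx : x + y ≤ b) : H y x = 0 := by
  have h1 := h.nonneg y hy x
  have h2 := h.le_top (c + b - y) y (by omega) x
  rw [Nat.cast_sub hy] at h2
  unfold hexTop at h2
  push_cast at h2
  omega

lemma IsHeight.eq_left_add (h : IsHeight (c + b) (hexTop a b c) H) {y : ℕ} (hy : y ≤ c + b)
    {x : ℤ} (hx : x ≤ 0) (hxy : b ≤ x + y) : H y x = x + y - b := by
  have h1 := h.top_le (c + b - y) y (by omega) x
  have h2 := h.le_top (c + b - y) y (by omega) x
  rw [Nat.cast_sub hy] at h1 h2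
  unfold hexTop at h1 h2
  push_cast at h1 h2
  omega

lemma IsHeight.eq_right (h : IsHeight (c + b) (hexTop a b c) H) {y : ℕ} (hy : y ≤ c + b)
    {x : ℤ} (hx : a + b ≤ x) : H y x = y := by
  have h1 := h.top_le (c + b - y) y (by omega) x
  have h2 := h.le_row y (by omega) x
  rw [Nat.cast_sub hy] at h1
  unfold hexTop at h1
  push_cast at h1
  omega

lemma IsHeight.eq_right_sub (h : IsHeight (c + b) (hexTop a b c) H) {y : ℕ} (hy : y ≤ c + b)
    {x : ℤ} (hx : x ≤ a + b) (hxy : a + b + c ≤ x + y) : H y x = x + y - a - b := by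
  have h1 := h.top_le (c + b - y) y (by omega) x
  have h2 := h.le_top (c + b - y) y (by omega) x
  rw [Nat.cast_sub hy] at h1 h2
  unfold hexTop at h1 h2
  push_cast at h1 h2
  omega

lemma IsHeight.isMatching (h : IsHeight (c + b) (hexTop a b c) H) :
    IsMatching (Hex a b c)
      (fun k x y => (x, y, true) ∈ Hex a b c ∧ heightDiff H k x y.toNat = 1) := by
  refine ⟨?_, ?_, ?_⟩
  · rintro k x y ⟨hm, hk⟩
    refine ⟨hm, ?_⟩
    rw [up_mem_Hex] at hm
    obtain ⟨y, rfl⟩ := Int.eq_ofNat_of_zero_le hm.2.2.1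
    rw [Int.toNat_natCast] at hk
    have hy : y < c + b := by omega
    fin_cases k <;> simp only [downNeighbor, heightDiff] at hk ⊢ <;> rw [down_mem_Hex]
    · have h1 := h.eq_right_sub (y := y + 1) (x := x) (by omega) (by omega)
      have h2 := h.eq_right_sub (y := y) (x := x + 1) (by omega) (by omega)
      push_cast at h1
      omega
    · have h1 := h.eq_left_add (y := y + 1) (x := x) (by omega)
      have h2 := h.eq_left_add (y := y) (x := x) (by omega)
      push_cast at h1
      omega
    · have hy0 : y ≠ 0 := by
        rintro rfl
        simp [h.bot] at hk
      omega
  · intro x y hm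
    have hm' := hm
    rw [up_mem_Hex] at hm'
    obtain ⟨y, rfl⟩ := Int.eq_ofNat_of_zero_le hm'.2.2.1
    have hy : y < c + b := by omega
    rw [existsUnique_fin_three]
    simp only [hm, true_and, Int.toNat_natCast, heightDiff]
    have h1 := h.mono y hy x
    have h2 := h.shift y hy x
    have h3 := h.step y hy x
    omega
  · intro x y hm
    refine (existsUnique_downNeighbor
      (fun k x y => (x, y, true) ∈ Hex a b c ∧ heightDiff H k x y.toNat = 1) x y).2 ?_
    rw [existsUnique_fin_three]
    rw [down_mem_Hex] at hm
    obtain ⟨y, rfl⟩ := Int.eq_ofNat_of_zero_le hm.2.2.1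
    have hy : y < c + b := by omega
    simp only [Matrix.cons_val, Int.toNat_natCast, heightDiff, up_mem_Hex,
      show ((y : ℤ) + 1).toNat = y + 1 by omega]
    have h1 := h.shift y hy x
    have h2 := h.step y hy (x + 1)
    have h3 : H (y + 1) x ≤ H (y + 1) (x + 1) := by
      obtain hy' | hy' := Nat.lt_or_eq_of_le (Nat.succ_le_of_lt hy)
      · exact h.mono (y + 1) hy' x
      · rw [show y + 1 = c + b from hy', h.top]
        unfold hexTop
        omega
    have h4 : y + 1 = c + b → H (y + 1) (x + 1) = H (y + 1) x := fun hy' => by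
      rw [hy', h.top]
      unfold hexTop
      omega
    have h5 := h.eq_left_zero (y := y + 1) (x := x) (by omega)
    have h6 := h.eq_left_zero (y := y) (x := x + 1) (by omega)
    have h7 := h.eq_right (y := y + 1) (x := x + 1) (by omega)
    have h8 := h.eq_right (y := y) (x := x + 1) (by omega)
    push_cast at h5 h7
    omega

lemma IsHeight.eq_of_heightDiff {G : ℕ → ℤ → ℤ} (h : IsHeight (c + b) (hexTop a b c) H)
    (hG : IsHeight (c + b) (hexTop a b c) G)
    (heq : ∀ (x : ℤ) (y : ℕ), (x, (y : ℤ), true) ∈ Hex a b c →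
      (heightDiff H 1 x y = 1 ↔ heightDiff G 1 x y = 1)) : H = G := by
  have aux (y : ℕ) (hy : y ≤ c + b) : H y = G y := by
    induction y with
    | zero => rw [h.bot, hG.bot]
    | succ y ih =>
      have ih := ih (by omega)
      funext x
      have h0 := congrFun ih x
      by_cases hm : (x, (y : ℤ), true) ∈ Hex a b c
      · have h1 := heq x y hm
        simp only [heightDiff] at h1
        have := h.mono y hy x
        have := h.shift y hy x
        have := h.step y hy x
        have := hG.mono y hy x
        have := hG.shift y hy x
        have := hG.step y hy x
        omega
      · rw [up_mem_Hex] at hm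
        have h1 := h.eq_left_zero (y := y + 1) (x := x) hy
        have h2 := h.eq_left_add (y := y + 1) (x := x) hy
        have h3 := h.eq_right (y := y + 1) (x := x) hy
        have h4 := h.eq_right_sub (y := y + 1) (x := x) hy
        have g1 := hG.eq_left_zero (y := y + 1) (x := x) hy
        have g2 := hG.eq_left_add (y := y + 1) (x := x) hy
        have g3 := hG.eq_right (y := y + 1) (x := x) hy
        have g4 := hG.eq_right_sub (y := y + 1) (x := x) hy
        push_cast at h1 h2 h3 h4 g1 g2 g3 g4
        omega
  funext y
  obtain hy | hy := Nat.lt_or_ge (c + b) y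
  · rw [h.above y hy, hG.above y hy]
  · exact aux y hy

open Classical in
/-- The indicator of the lozenge in direction `k` with up-triangle `(x, y)`, extended from the
hexagon to the strip by the frozen lozenges outside the hexagon. -/
noncomputable def stripIndicator (a b c : ℕ) (E : Fin 3 → ℤ → ℤ → Prop) (k : Fin 3)
    (x y : ℤ) : ℤ :=
  if (x, y, true) ∈ Hex a b c then if E k x y then 1 else 0
  else match k with
    | 0 => if a + b ≤ x then 1 else 0
    | 1 => if x + y < b then 1 else 0
    | 2 => if (x < 0 ∧ b ≤ x + y) ∨ (a + b + c ≤ x + y ∧ x < a + b) then 1 else 0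

section

variable {E : Fin 3 → ℤ → ℤ → Prop}

open Classical in
lemma stripIndicator_of_mem {k : Fin 3} {x y : ℤ} (h : (x, y, true) ∈ Hex a b c) :
    stripIndicator a b c E k x y = if E k x y then 1 else 0 := by
  unfold stripIndicator
  rw [if_pos h]

lemma stripIndicator_nonneg (k : Fin 3) (x y : ℤ) : 0 ≤ stripIndicator a b c E k x y := by
  unfold stripIndicator
  fin_cases k <;> dsimp only <;> split_ifs <;> norm_num

lemma IsMatching.stripIndicator_up (hE : IsMatching (Hex a b c) E) (x : ℤ) {y : ℤ} (hy : 0 ≤ y)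
    (hyn : y < c + b) : stripIndicator a b c E 0 x y + stripIndicator a b c E 1 x y +
      stripIndicator a b c E 2 x y = 1 := by
  unfold stripIndicator
  by_cases hm : (x, y, true) ∈ Hex a b c
  · have h := hE.up x y hm
    rw [existsUnique_fin_three] at h
    simp only [hm, if_true]
    obtain ⟨h0, h1, h2⟩ | ⟨h0, h1, h2⟩ | ⟨h0, h1, h2⟩ := h <;> simp [h0, h1, h2]
  · simp only [hm, if_false]
    rw [up_mem_Hex] at hm
    split_ifs <;> omega

lemma IsMatching.stripIndicator_down (hE : IsMatching (Hex a b c) E) (x : ℤ) {y : ℤ} (hy : 0 ≤ y)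
    (hyn : y < c + b) : stripIndicator a b c E 0 x y + stripIndicator a b c E 1 (x + 1) y +
      stripIndicator a b c E 2 x (y + 1) = 1 := by
  unfold stripIndicator
  have h0 := hE.mem 0 x y
  have h1 := hE.mem 1 (x + 1) y
  have h2 := hE.mem 2 x (y + 1)
  simp only [downNeighbor, add_sub_cancel_right] at h0 h1 h2
  by_cases hm : (x, y, false) ∈ Hex a b c
  · have h := hE.down x y hm
    rw [existsUnique_downNeighbor, existsUnique_fin_three] at h
    simp only [Matrix.cons_val] at h
    rw [down_mem_Hex] at hm
    obtain ⟨e0, e1, e2⟩ | ⟨e0, e1, e2⟩ | ⟨e0, e1, e2⟩ := h <;>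
      simp only [e0, e1, e2, true_imp_iff, false_imp_iff, if_true, if_false, up_mem_Hex]
        at h0 h1 h2 ⊢ <;> split_ifs <;> omega
  · simp only [hm, and_false, imp_false] at h0 h1 h2
    rw [down_mem_Hex] at hm
    simp only [h0, h1, h2, if_false, up_mem_Hex]
    split_ifs <;> omega

lemma IsMatching.stripIndicator_bot (hE : IsMatching (Hex a b c) E) (x : ℤ) :
    stripIndicator a b c E 2 x 0 = 0 := by
  have h := hE.mem 2 x 0
  simp only [downNeighbor, down_mem_Hex] at h
  have h' : ¬ E 2 x 0 := fun hx => by have := (h hx).2; omega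
  simp only [stripIndicator, h', if_false]
  split_ifs <;> omega

lemma stripIndicator_top (x : ℤ) :
    stripIndicator a b c E 2 x ((c + b : ℕ) : ℤ) = hexTop a b c (x + 1) - hexTop a b c x := by
  simp only [stripIndicator, up_mem_Hex, hexTop]
  push_cast
  split_ifs <;> omega

lemma stripIndicator_left {x y : ℤ} (h : x + y < b) : stripIndicator a b c E 1 x y = 1 := by
  simp only [stripIndicator, up_mem_Hex]
  rw [if_neg (by omega), if_pos h]

/-- The height function of a matching of the hexagon, extended to the strip. -/
noncomputable def stripHeight (a b c : ℕ) (E : Fin 3 → ℤ → ℤ → Prop) (y : ℕ) (x : ℤ) : ℤ :=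
  if y ≤ c + b then ∑ j ∈ range y, (1 - stripIndicator a b c E 1 x j) else 0

lemma stripHeight_succ {y : ℕ} (hy : y < c + b) (x : ℤ) : stripHeight a b c E (y + 1) x =
    stripHeight a b c E y x + (1 - stripIndicator a b c E 1 x y) := by
  rw [stripHeight, stripHeight, if_pos (by omega), if_pos (by omega), sum_range_succ]

lemma IsMatching.stripHeight_right (hE : IsMatching (Hex a b c) E) {y : ℕ} (hy : y ≤ c + b)
    (x : ℤ) : stripHeight a b c E y (x + 1) =
      stripHeight a b c E y x + stripIndicator a b c E 2 x y := by
  induction y with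
  | zero => simp [stripHeight, hE.stripIndicator_bot]
  | succ y ih =>
    have h1 := hE.stripIndicator_up x (y := y) (by omega) (by omega)
    have h2 := hE.stripIndicator_down x (y := y) (by omega) (by omega)
    rw [stripHeight_succ hy, stripHeight_succ hy, ih (by omega)]
    push_cast
    linarith

lemma IsMatching.heightDiff_stripHeight (hE : IsMatching (Hex a b c) E) (k : Fin 3) {y : ℕ}
    (hy : y < c + b) (x : ℤ) :
    heightDiff (stripHeight a b c E) k x y = stripIndicator a b c E k x y := by
  have h1 := hE.stripIndicator_up x (y := y) (by omega) (by omega)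
  have h2 := hE.stripHeight_right hy.le x
  have h3 := stripHeight_succ (a := a) (E := E) hy x
  match k with
  | 0 => simp only [heightDiff]; linarith
  | 1 => simp only [heightDiff]; linarith
  | 2 => simp only [heightDiff]; linarith

lemma IsMatching.stripHeight_top (hE : IsMatching (Hex a b c) E) :
    stripHeight a b c E (c + b) = hexTop a b c := by
  have hleft {x : ℤ} (hx : x ≤ -c) : stripHeight a b c E (c + b) x = hexTop a b c x := by
    rw [stripHeight, if_pos le_rfl, sum_eq_zero fun j hj => ?_]
    · unfold hexTop
      omega
    · have := mem_range.1 hj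
      rw [stripIndicator_left (by omega), sub_self]
  funext x
  obtain hx | hx := le_total x (-c)
  · exact hleft hx
  · induction x, hx using Int.leInduction with
    | base => exact hleft le_rfl
    | succ x hx ih =>
      rw [hE.stripHeight_right le_rfl, ih, stripIndicator_top]
      ring

lemma IsMatching.isHeight_stripHeight (hE : IsMatching (Hex a b c) E) :
    IsHeight (c + b) (hexTop a b c) (stripHeight a b c E) := by
  refine ⟨funext fun x => by simp [stripHeight], hE.stripHeight_top,
    fun y hy => funext fun x => if_neg (by omega), fun y hy x => ?_, fun y hy x => ?_,
    fun y hy x => ?_⟩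
  · have h1 := hE.heightDiff_stripHeight 2 hy x
    have h2 := stripIndicator_nonneg (a := a) (b := b) (c := c) (E := E) 2 x y
    simp only [heightDiff] at h1
    omega
  · have h1 := hE.heightDiff_stripHeight 0 hy x
    have h2 := stripIndicator_nonneg (a := a) (b := b) (c := c) (E := E) 0 x y
    simp only [heightDiff] at h1
    omega
  · have h1 := hE.heightDiff_stripHeight 1 hy x
    have h2 := stripIndicator_nonneg (a := a) (b := b) (c := c) (E := E) 1 x y
    simp only [heightDiff] at h1
    omega

end

end

lemma card_isMatching_Hex (a b c : ℕ) : Nat.card {E // IsMatching (Hex a b c) E} =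
    Nat.card {H // IsHeight (c + b) (hexTop a b c) H} := by
  symm
  refine Nat.card_eq_of_bijective (fun H => ⟨_, H.2.isMatching⟩) ⟨?_, ?_⟩
  · rintro ⟨H, hH⟩ ⟨G, hG⟩ heq
    refine Subtype.ext (hH.eq_of_heightDiff hG fun x y hm => ?_)
    have := congrFun (congrFun (congrFun (congrArg Subtype.val heq) 1) x) (y : ℤ)
    simpa [hm] using this
  · rintro ⟨E, hE⟩
    refine ⟨⟨_, hE.isHeight_stripHeight⟩, Subtype.ext ?_⟩
    funext k x y
    refine propext ⟨?_, fun h => ?_⟩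
    · rintro ⟨hm, h⟩
      have hm' := up_mem_Hex.1 hm
      rw [hE.heightDiff_stripHeight k (by omega), Int.toNat_of_nonneg hm'.2.2.1,
        stripIndicator_of_mem hm] at h
      change E k x y
      by_contra hc
      rw [if_neg hc] at h
      exact absurd h (by norm_num)
    · have hm := (hE.mem k x y h).1
      have hm' := up_mem_Hex.1 hm
      refine ⟨hm, ?_⟩
      rw [hE.heightDiff_stripHeight k (by omega), Int.toNat_of_nonneg hm'.2.2.1,
        stripIndicator_of_mem hm, if_pos h]

/-- MacMahon's theorem: the number of lozenge tilings of the hexagon `H_{a,b,c}` equals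
`∏_{i=1}^a ∏_{j=1}^b ∏_{k=1}^c (i+j+k-1)/(i+j+k-2)`. -/
theorem macmahon_hexagon (a b c : ℕ) :
    (M (Hex a b c) : ℚ) =
      ∏ i ∈ Finset.Icc 1 a, ∏ j ∈ Finset.Icc 1 b, ∏ k ∈ Finset.Icc 1 c,
        ((i : ℚ) + j + k - 1) / ((i : ℚ) + j + k - 2) := by
  have hmono : StrictMono (fun i : Fin (c + b) =>
      if (i : ℕ) < c then ((i : ℕ) : ℤ) - c else a + (i : ℕ) - c) := fun i j hij => by
    have : (i : ℕ) < j := hij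
    dsimp only
    split_ifs <;> omega
  have h := (card_isHeight (c + b) _ hmono _ (isCounting_hexTop a b c)).2
  rw [vandermonde_two_blocks] at h
  rw [M_eq_card_isMatching, card_isMatching_Hex]
  exact mul_right_cancel₀ (prod_ne_zero_iff.2 fun j _ => by positivity) h
end

section
/- Let a, b, c, k be nonnegative integers and l an integer with 0 ≤ l ≤ c+k. Let H'_{a,b,c}(k,l) be the region obtained from the hexagon with side lengths a, b+k+1, c, a+k+1, b, c+k+1 (clockwise from the top side) by removing an up-pointing unit triangle from its northwestern side, l units above the western corner, and an up-pointing lattice triangle of side k from its northeastern side, one unit below the northeastern corner. Set m = min(a,b), M = max(a,b), ν = min(b−1,k), and define r(c) := ∏_{t=1}^{b+k−2} (c+1+t)^{min(t,ν,b+k−1−t)} if ν ≥ 0 (this product is 1 when ν = 0), and r(c) := 1/(c+1)_k if ν = −1 (i.e., b = 0). Define q(c,l) := r(c) · (l+1)_b · (c+k−l+1)_a · ∏_{t=1}^{M+m−1} (c+k+1+t)^{min(t,m,M+m−t)} · Σ_{i=1}^{k+1} [(−1)^{i−1} / ((i−1)!·(k−i+1)!)] · (l−k+i)_{k−i+1}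 · (l+b+1)_{i−1} · (l−k−c)_{i−1} · (l−k−c+i)_{k−i+1}. Then M(H'_{a,b,c}(k,l)) = binomial(a+k, k) · q(c,l)/q(0,0). -/
/-- The rising factorial (Pochhammer symbol) `(x)_n = x (x+1) ⋯ (x+n-1)`. -/
def rF (x : ℚ) (n : ℕ) : ℚ := ∏ t ∈ Finset.range n, (x + t)

/-- The up-pointing lattice triangle of side `k` whose corner vertices are
`(X,Y)`, `(X+k,Y)` and `(X,Y+k)`, as a set of unit triangles. -/
def BigTri (X Y : ℤ) (k : ℕ) : Set Tri :=
  {t | X ≤ t.1 ∧ Y ≤ t.2.1 ∧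
    (if t.2.2 then t.1 + t.2.1 ≤ X + Y + k - 1 else t.1 + t.2.1 ≤ X + Y + k - 2)}

/-- The region `H'_{a,b,c}(k,l)`: the hexagon with side lengths
`a, b+k+1, c, a+k+1, b, c+k+1` (clockwise from the top side), with an up-pointing unit
triangle removed from its northwestern side `l` units above the western corner, and an
up-pointing lattice triangle of side `k` removed from its northeastern side one unit
below the northeastern corner. -/
def HexDentB (a b c k l : ℕ) : Set Tri :=
  HexK a b c (k + 1) \
    ({((0 : ℤ), (b : ℤ) + l, true)} ∪ BigTri ((a : ℤ) + 1) ((b : ℤ) + c) k)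

/-- The factor `r(c)`:  for `ν = min(b-1,k) ≥ 0` (i.e. `b ≥ 1`) it is
`∏_{t=1}^{b+k-2} (c+1+t)^{min(t,ν,b+k-1-t)}`, and for `ν = -1` (i.e. `b = 0`) it is
`1/(c+1)_k`. -/
noncomputable def rFac (b k : ℕ) (c : ℚ) : ℚ :=
  if b = 0 then 1 / rF (c + 1) k
  else ∏ t ∈ Finset.Icc 1 (b + k - 2), (c + 1 + t) ^ min t (min (min (b - 1) k) (b + k - 1 - t))

/-- The polynomial `q(c,l)` of Proposition 4.2(b). -/
noncomputable def qPoly (a b k : ℕ) (c l : ℚ) : ℚ :=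
  rFac b k c * rF (l + 1) b * rF (c + k - l + 1) a *
    (∏ t ∈ Finset.Icc 1 (max a b + min a b - 1),
      (c + k + 1 + t) ^ min t (min (min a b) (max a b + min a b - t))) *
    ∑ i ∈ Finset.Icc 1 (k + 1),
      (-1 : ℚ) ^ (i - 1) / ((Nat.factorial (i - 1) : ℚ) * (Nat.factorial (k + 1 - i) : ℚ)) *
        rF (l - k + i) (k + 1 - i) * rF (l + b + 1) (i - 1) * rF (l - k - c) (i - 1) *
        rF (l - k - c + i) (k + 1 - i)

lemma adj_down_iff (s : Tri) (x y : ℤ) :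
    Adj s (x, y, false) ↔ s = (x, y, true) ∨ s = (x + 1, y, true) ∨ s = (x, y + 1, true) := by
  obtain ⟨u, v, e⟩ := s
  simp only [Adj, Set.pair_eq_pair_iff, Prod.mk.injEq]
  constructor
  · rintro ⟨x', y', h⟩
    grind
  · rintro (h | h | h)
    · exact ⟨x, y, by grind⟩
    · exact ⟨x + 1, y, by grind⟩
    · exact ⟨x, y + 1, by grind⟩

lemma adj_up_iff (s : Tri) (x y : ℤ) :
    Adj s (x, y, true) ↔ s = (x, y, false) ∨ s = (x - 1, y, false) ∨ s = (x, y - 1, false) := by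
  obtain ⟨u, v, e⟩ := s
  simp only [Adj, Set.pair_eq_pair_iff, Prod.mk.injEq]
  constructor
  · rintro ⟨x', y', h⟩
    grind
  · rintro (h | h | h) <;> exact ⟨x, y, by grind⟩

lemma Adj.symm {s t : Tri} (h : Adj s t) : Adj t s := by
  unfold Adj at *
  rwa [Set.pair_comm t s]

lemma Adj.ne {s t : Tri} (h : Adj s t) : s ≠ t := by
  rintro rfl
  obtain ⟨x, y, e⟩ := s
  cases e
  · simp [adj_down_iff] at h
  · simp [adj_up_iff] at h

lemma finite_tilings {R : Set Tri} (hR : R.Finite) :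
    Finite {P : Set (Set Tri) // IsLozengeTiling R P} := by
  have h : {P : Set (Set Tri) | IsLozengeTiling R P} ⊆ 𝒫 (𝒫 R) := fun P hP L hL => hP.2.1 L hL
  exact (hR.powerset.powerset.subset h).to_subtype

lemma M_empty : M ∅ = 1 := by
  unfold M
  rw [Nat.card_eq_one_iff_unique]
  refine ⟨⟨fun P Q => ?_⟩, ⟨⟨∅, ?_⟩⟩⟩
  · have key : ∀ P : {P : Set (Set Tri) // IsLozengeTiling ∅ P}, P.1 = ∅ := by
      rintro ⟨P, h1, h2, -⟩
      rw [Set.eq_empty_iff_forall_notMem]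
      intro L hL
      obtain ⟨s, t, -, rfl⟩ := h1 L hL
      exact h2 _ hL (Set.mem_insert s {t})
    exact Subtype.ext ((key P).trans (key Q).symm)
  · simp [IsLozengeTiling]

lemma IsLozengeTiling.insert_pair {R : Set Tri} {s t : Tri} {P : Set (Set Tri)}
    (hs : s ∈ R) (ht : t ∈ R) (hst : Adj s t) (hP : IsLozengeTiling (R \ {s, t}) P) :
    IsLozengeTiling R (insert {s, t} P) := by
  obtain ⟨h1, h2, h3⟩ := hP
  refine ⟨?_, ?_, ?_⟩
  · rintro L (rfl | hL)
    · exact ⟨s, t, hst, rfl⟩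
    · exact h1 L hL
  · rintro L (rfl | hL)
    · rintro r (rfl | rfl) <;> assumption
    · exact (h2 L hL).trans Set.sdiff_subset
  · intro r hr
    by_cases hrs : r ∈ ({s, t} : Set Tri)
    · refine ⟨{s, t}, ⟨Set.mem_insert _ _, hrs⟩, ?_⟩
      rintro L ⟨rfl | hL, hrL⟩
      · rfl
      · exact absurd hrs (h2 L hL hrL).2
    · obtain ⟨L, ⟨hL, hrL⟩, hu⟩ := h3 r ⟨hr, hrs⟩
      refine ⟨L, ⟨Set.mem_insert_of_mem _ hL, hrL⟩, ?_⟩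
      rintro L' ⟨rfl | hL', hrL'⟩
      · exact absurd hrL' hrs
      · exact hu L' ⟨hL', hrL'⟩

lemma IsLozengeTiling.diff_singleton {R L : Set Tri} {P : Set (Set Tri)}
    (hP : IsLozengeTiling R P) (hL : L ∈ P) : IsLozengeTiling (R \ L) (P \ {L}) := by
  obtain ⟨h1, h2, h3⟩ := hP
  refine ⟨fun L' hL' => h1 L' hL'.1, ?_, ?_⟩
  · rintro L' ⟨hL', hne⟩ r hr
    refine ⟨h2 L' hL' hr, fun hrL => hne ?_⟩
    exact (h3 r (h2 L' hL' hr)).unique ⟨hL', hr⟩ ⟨hL, hrL⟩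
  · rintro r ⟨hr, hrL⟩
    obtain ⟨L', ⟨hL', hrL'⟩, hu⟩ := h3 r hr
    refine ⟨L', ⟨⟨hL', ?_⟩, hrL'⟩, fun L'' h => hu L'' ⟨h.1.1, h.2⟩⟩
    rintro rfl
    exact hrL hrL'

/-- Expansion of the number of tilings according to the partner of a given triangle. -/
lemma M_eq_sum {R : Set Tri} (hR : R.Finite) {t : Tri} (ht : t ∈ R) (S : Finset Tri)
    (hS : ∀ s, s ∈ S ↔ Adj s t ∧ s ∈ R) : M R = ∑ s ∈ S, M (R \ {s, t}) := by
  have hfin : ∀ s : S, Finite {P : Set (Set Tri) // IsLozengeTiling (R \ {s.1, t}) P} :=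
    fun s => finite_tilings (hR.subset Set.sdiff_subset)
  rw [← Finset.sum_coe_sort S fun s => M (R \ {s, t})]
  unfold M
  rw [← Nat.card_sigma]
  symm
  refine Nat.card_congr (Equiv.ofBijective
    (fun p => ⟨insert {p.1.1, t} p.2.1,
      p.2.2.insert_pair ((hS _).1 p.1.2).2 ht ((hS _).1 p.1.2).1⟩) ⟨?_, ?_⟩)
  · have hnot : ∀ (s : S) (P : {P : Set (Set Tri) // IsLozengeTiling (R \ {s.1, t}) P})
        (L : Set Tri), t ∈ L → L ∉ P.1 := fun s P L htL hL => by
      have := P.2.2.1 L hL htL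
      simp at this
    rintro ⟨s, P⟩ ⟨s', P'⟩ h
    have h' : insert {s.1, t} P.1 = insert {s'.1, t} P'.1 := congrArg Subtype.val h
    have hs : s = s' := by
      have h1 : ({s.1, t} : Set Tri) ∈ insert {s'.1, t} P'.1 := h' ▸ Set.mem_insert _ _
      rcases h1 with h1 | h1
      · have h2 : s.1 ∈ ({s'.1, t} : Set Tri) := h1 ▸ Set.mem_insert _ _
        rcases h2 with h2 | h2
        · exact Subtype.ext h2
        · exact absurd h2 ((hS _).1 s.2).1.ne
      · exact absurd h1 (hnot s' P' _ (by simp))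
    subst hs
    have hP : P = P' := by
      refine Subtype.ext (Set.ext fun L => ?_)
      have hL : L ∈ insert {s.1, t} P.1 ↔ L ∈ insert {s.1, t} P'.1 := by rw [h']
      by_cases htL : t ∈ L
      · exact ⟨fun h => absurd h (hnot s P L htL), fun h => absurd h (hnot s P' L htL)⟩
      · have hne : L ≠ {s.1, t} := by rintro rfl; simp at htL
        simpa [hne] using hL
    rw [hP]
  · rintro ⟨P, hP⟩
    obtain ⟨L, ⟨hL, htL⟩, -⟩ := hP.2.2 t ht
    obtain ⟨s, hst, rfl⟩ : ∃ s, Adj s t ∧ L = {s, t} := by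
      obtain ⟨u, v, huv, rfl⟩ := hP.1 L hL
      rcases htL with rfl | htL
      · exact ⟨v, huv.symm, Set.pair_comm _ _⟩
      · obtain rfl : t = v := htL
        exact ⟨u, huv, rfl⟩
    refine ⟨⟨⟨s, (hS s).2 ⟨hst, hP.2.1 _ hL (by simp)⟩⟩, ⟨P \ {{s, t}}, hP.diff_singleton hL⟩⟩, ?_⟩
    refine Subtype.ext ?_
    simp [Set.insert_eq_of_mem hL]

/-- The region consisting of `A`, of the up-triangles `(x, t - x)` with `x ∈ U` and of the
down-triangles `(x, t - 1 - x)` with `x ∈ D`. -/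
def stripRegion (A : Set Tri) (t : ℤ) (D U : Finset ℤ) : Set Tri :=
  A ∪ {τ | (τ.2.2 = true ∧ τ.1 ∈ U ∧ τ.1 + τ.2.1 = t) ∨
    (τ.2.2 = false ∧ τ.1 ∈ D ∧ τ.1 + τ.2.1 = t - 1)}

/-- All triangles of `A` lie beyond the line `x + y = t + 1`. -/
def Beyond (A : Set Tri) (t : ℤ) : Prop :=
  ∀ τ ∈ A, if τ.2.2 then t + 1 ≤ τ.1 + τ.2.1 else t ≤ τ.1 + τ.2.1

lemma finite_stripRegion {A : Set Tri} (hA : A.Finite) (t : ℤ) (D U : Finset ℤ) :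
    (stripRegion A t D U).Finite := by
  refine hA.union (((U.finite_toSet.image fun x => ((x, t - x, true) : Tri)).union
    (D.finite_toSet.image fun x => ((x, t - 1 - x, false) : Tri))).subset ?_)
  rintro ⟨x, y, e⟩ (⟨rfl, hx, hy⟩ | ⟨rfl, hx, hy⟩)
  · exact Or.inl ⟨x, hx, by simp only [Prod.mk.injEq, and_true, true_and]; simp only at hy; omega⟩
  · exact Or.inr ⟨x, hx, by simp only [Prod.mk.injEq, and_true, true_and]; simp only at hy; omega⟩

lemma mem_stripRegion_up {A : Set Tri} {t : ℤ} {D U : Finset ℤ} {x y : ℤ} :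
    (x, y, true) ∈ stripRegion A t D U ↔ (x, y, true) ∈ A ∨ (x ∈ U ∧ x + y = t) := by
  simp [stripRegion]

lemma mem_stripRegion_down {A : Set Tri} {t : ℤ} {D U : Finset ℤ} {x y : ℤ} :
    (x, y, false) ∈ stripRegion A t D U ↔ (x, y, false) ∈ A ∨ (x ∈ D ∧ x + y = t - 1) := by
  simp [stripRegion]

lemma stripRegion_diff {A : Set Tri} {t : ℤ} {D U : Finset ℤ} (hA : Beyond A t) (d u : ℤ) :
    stripRegion A t D U \ {(u, t - u, true), (d, t - 1 - d, false)} =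
      stripRegion A t (D.erase d) (U.erase u) := by
  ext ⟨x, y, e⟩
  have := hA (x, y, e)
  cases e
  · simp [mem_stripRegion_down] at this ⊢
    grind
  · simp [mem_stripRegion_up] at this ⊢
    grind

lemma M_stripRegion_erase {A : Set Tri} (hfin : A.Finite) {t : ℤ} {D U : Finset ℤ}
    (hA : Beyond A t) {d : ℤ} (hd : d ∈ D) :
    M (stripRegion A t D U) =
      (if d ∈ U then M (stripRegion A t (D.erase d) (U.erase d)) else 0) +
      (if d + 1 ∈ U then M (stripRegion A t (D.erase d) (U.erase (d + 1))) else 0) := by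
  classical
  have hmem : ∀ x y : ℤ, x + y ≤ t → ((x, y, true) ∈ stripRegion A t D U ↔ x ∈ U ∧ x + y = t) := by
    intro x y hxy
    rw [mem_stripRegion_up, or_iff_right]
    intro h
    have := hA _ h
    simp at this
    omega
  rw [M_eq_sum (finite_stripRegion hfin t D U) (t := (d, t - 1 - d, false))
    (mem_stripRegion_down.2 (Or.inr ⟨hd, by ring⟩))
    (({d, d + 1} : Finset ℤ).filter (· ∈ U) |>.image fun u => (u, t - u, true))]
  · rw [Finset.sum_image (by intro x _ y _ h; simpa using (Prod.ext_iff.1 h).1), Finset.sum_filter,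
      Finset.sum_pair (by omega)]
    simp only [stripRegion_diff hA]
  · rintro s
    rw [adj_down_iff]
    constructor
    · simp only [Finset.mem_image, Finset.mem_filter, Finset.mem_insert, Finset.mem_singleton]
      rintro ⟨u, ⟨rfl | rfl, hu⟩, rfl⟩
      · exact ⟨Or.inr (Or.inr (by simp; ring)), (hmem _ _ (by omega)).2 ⟨hu, by ring⟩⟩
      · exact ⟨Or.inr (Or.inl (by simp; ring)), (hmem _ _ (by omega)).2 ⟨hu, by ring⟩⟩
    · rintro ⟨rfl | rfl | rfl, hs⟩
      · have := (hmem _ _ (by omega)).1 hs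
        omega
      · have := (hmem _ _ (by omega)).1 hs
        simp only [Finset.mem_image, Finset.mem_filter, Finset.mem_insert, Finset.mem_singleton]
        exact ⟨d + 1, ⟨Or.inr rfl, this.1⟩, by simp; ring⟩
      · have := (hmem _ _ (by omega)).1 hs
        simp only [Finset.mem_image, Finset.mem_filter, Finset.mem_insert, Finset.mem_singleton]
        exact ⟨d, ⟨Or.inl rfl, this.1⟩, by simp; ring⟩

lemma M_stripRegion_holes {A : Set Tri} (hfin : A.Finite) {t : ℤ} (hA : Beyond A t)
    (U : Finset ℤ) (hU : ∀ u ∈ U, (u, t - u, false) ∈ A) :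
    M (stripRegion A t ∅ U) = M (A \ {τ | τ.2.2 = false ∧ τ.1 ∈ U ∧ τ.1 + τ.2.1 = t}) := by
  classical
  induction U using Finset.induction_on generalizing A with
  | empty => simp [stripRegion]
  | insert u U hu ih =>
    rw [M_eq_sum (finite_stripRegion hfin t ∅ _) (t := (u, t - u, true))
      (mem_stripRegion_up.2 (Or.inr ⟨by simp, by ring⟩)) {(u, t - u, false)}]
    · have hB : Beyond (A \ {(u, t - u, false)}) t := fun τ hτ => hA τ hτ.1
      have h1 : stripRegion A t ∅ (insert u U) \ {(u, t - u, false), (u, t - u, true)} =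
          stripRegion (A \ {(u, t - u, false)}) t ∅ U := by
        ext ⟨x, y, e⟩
        have := hA (x, y, e)
        cases e
        · simp [mem_stripRegion_down] at this ⊢
        · simp [mem_stripRegion_up] at this ⊢
          grind
      rw [Finset.sum_singleton, h1, ih (hfin.subset Set.sdiff_subset) hB]
      · congr 1
        ext ⟨x, y, e⟩
        simp
        grind
      · intro v hv
        refine ⟨hU v (Finset.mem_insert_of_mem hv), ?_⟩
        rintro h
        simp at h
        exact hu (h ▸ hv)
    · intro s
      rw [adj_up_iff, Finset.mem_singleton]
      constructor
      · rintro rfl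
        exact ⟨Or.inl rfl, mem_stripRegion_down.2 (Or.inl (hU u (by simp)))⟩
      · rintro ⟨rfl | rfl | rfl, hs⟩
        · rfl
        all_goals
          rw [mem_stripRegion_down] at hs
          rcases hs with hs | ⟨hs, -⟩
          · have := hA _ hs
            simp only [Bool.false_eq_true, if_false] at this
            omega
          · simp at hs

/-- Transfer of an alternating expression across one strip: the particles `p` move to
`p` or `p + 1`, and the colliding configurations cancel. -/
lemma M_stripRegion_alternating {A : Set Tri} (hfin : A.Finite) {t : ℤ} (hA : Beyond A t)
    (U : Finset ℤ) {n : ℕ} {V : Type*} [AddCommGroup V] [Module ℚ V]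
    (p : Fin n → ℤ) (hp : StrictMono p) (φ : ℤ → V) (Φ : V [⋀^Fin n]→ₗ[ℚ] ℚ)
    (hΦ : ∀ i x, (x = p i ∨ x = p i + 1) → x ∉ U → ∀ v : Fin n → V, v i = φ x → Φ v = 0)
    (h : ∀ q : Fin n → ℤ, StrictMono q → (∀ i, q i ∈ U) →
      (M (stripRegion A t ∅ (U \ Finset.univ.image q)) : ℚ) = Φ (fun i => φ (q i))) :
    (M (stripRegion A t (Finset.univ.image p) U) : ℚ) = Φ (fun i => φ (p i) + φ (p i + 1)) := by
  classical
  have key : ∀ r m : ℕ, m + r = n → ∀ q : Fin n → ℤ,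
      (∀ i : Fin n, i.1 < m → (q i = p i ∨ q i = p i + 1) ∧ q i ∈ U) →
      (∀ i j : Fin n, i < j → j.1 < m → q i < q j) →
      (M (stripRegion A t ((Finset.univ.filter fun i : Fin n => m ≤ i.1).image p)
        (U \ (Finset.univ.filter fun i : Fin n => i.1 < m).image q)) : ℚ) =
      Φ (fun i => if i.1 < m then φ (q i) else φ (p i) + φ (p i + 1)) := by
    intro r
    induction r with
    | zero =>
      intro m hm q hq hmono
      obtain rfl : m = n := by omega
      have h1 : (Finset.univ.filter fun i : Fin m => m ≤ i.1) = ∅ := by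
        ext i; simp
      have h2 : (Finset.univ.filter fun i : Fin m => i.1 < m) = Finset.univ := by
        ext i; simp
      rw [h1, h2, Finset.image_empty, h q (fun i j hij => hmono i j hij j.2) fun i => (hq i i.2).2]
      simp
    | succ r ih =>
      intro m hm q hq hmono
      have hmn : m < n := by omega
      set k : Fin n := ⟨m, hmn⟩ with hk
      rw [M_stripRegion_erase hfin hA (d := p k)
        (Finset.mem_image_of_mem _ (by simp [hk]))]
      have hD : ((Finset.univ.filter fun i : Fin n => m ≤ i.1).image p).erase (p k) =
          (Finset.univ.filter fun i : Fin n => m + 1 ≤ i.1).image p := by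
        ext x
        simp only [Finset.mem_erase, Finset.mem_image, Finset.mem_filter, Finset.mem_univ, true_and]
        constructor
        · rintro ⟨hne, i, hi, rfl⟩
          refine ⟨i, ?_, rfl⟩
          rcases Nat.lt_or_eq_of_le hi with h' | h'
          · exact h'
          · exact absurd (congrArg p (Fin.ext h'.symm : i = k)) hne
        · rintro ⟨i, hi, rfl⟩
          refine ⟨fun h' => ?_, i, by omega, rfl⟩
          have := congrArg Fin.val (hp.injective h')
          simp [hk] at this
          omega
      have hsplit : (fun i : Fin n => if i.1 < m then φ (q i) else φ (p i) + φ (p i + 1)) =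
          Function.update (fun i : Fin n => if i.1 < m then φ (q i) else φ (p i) + φ (p i + 1)) k
            (φ (p k) + φ (p k + 1)) := by
        ext i
        by_cases hi : i = k
        · subst hi; simp [hk]
        · simp [hi]
      have hterm : ∀ y : ℤ, (y = p k ∨ y = p k + 1) →
          ((if y ∈ U \ (Finset.univ.filter fun i : Fin n => i.1 < m).image q then
            M (stripRegion A t ((Finset.univ.filter fun i : Fin n => m + 1 ≤ i.1).image p)
              ((U \ (Finset.univ.filter fun i : Fin n => i.1 < m).image q).erase y)) else 0 : ℕ) : ℚ)
          = Φ (Function.update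
            (fun i : Fin n => if i.1 < m then φ (q i) else φ (p i) + φ (p i + 1)) k (φ y)) := by
        intro y hy
        split_ifs with hyU
        · obtain ⟨hyU, hyq⟩ := Finset.mem_sdiff.1 hyU
          have hne : ∀ i : Fin n, i.1 < m → q i ≠ y := fun i hi h' =>
            hyq (Finset.mem_image.2 ⟨i, by simpa using hi, h'⟩)
          have hqv : ∀ i : Fin n, i.1 < m → Function.update q k y i = q i := fun i hi =>
            Function.update_of_ne (by rintro rfl; simp [hk] at hi) _ _
          have hU' : (U \ (Finset.univ.filter fun i : Fin n => i.1 < m).image q).erase y =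
              U \ (Finset.univ.filter fun i : Fin n => i.1 < m + 1).image (Function.update q k y) := by
            ext x
            simp only [Finset.mem_erase, Finset.mem_sdiff, Finset.mem_image, Finset.mem_filter,
              Finset.mem_univ, true_and, not_exists, not_and]
            constructor
            · rintro ⟨hxy, hx, hx'⟩
              refine ⟨hx, fun i hi h' => ?_⟩
              rcases Nat.lt_or_eq_of_le (Nat.le_of_lt_succ hi) with h1 | h1
              · exact hx' i h1 (hqv i h1 ▸ h')
              · obtain rfl : i = k := Fin.ext h1
                simp at h'
                exact hxy h'.symm
            · rintro ⟨hx, hx'⟩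
              refine ⟨fun h' => hx' k (by simp [hk]) (by simp [h']), hx, fun i hi h' => ?_⟩
              exact hx' i (by omega) (by rw [hqv i hi, h'])
          rw [hU', ih (m + 1) (by omega)]
          · congr 1
            ext i
            by_cases hi : i = k
            · subst hi; simp [hk]
            · have : i.1 ≠ m := fun h' => hi (Fin.ext h')
              simp only [Function.update_of_ne hi]
              by_cases h1 : i.1 < m
              · rw [if_pos h1, if_pos (by omega)]
              · rw [if_neg h1, if_neg (by omega)]
          · intro i hi
            rcases Nat.lt_or_eq_of_le (Nat.le_of_lt_succ hi) with h1 | h1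
            · rw [hqv i h1]; exact hq i h1
            · obtain rfl : i = k := Fin.ext h1
              simpa using ⟨hy, hyU⟩
          · intro i j hij hj
            have hi : i.1 < m := by have : i.1 < j.1 := hij; omega
            rw [hqv i hi]
            rcases Nat.lt_or_eq_of_le (Nat.le_of_lt_succ hj) with h1 | h1
            · rw [hqv j h1]; exact hmono i j hij h1
            · obtain rfl : j = k := Fin.ext h1
              have h2 := hp hij
              have h3 := (hq i hi).1
              have h4 := hne i hi
              simp only [Function.update_self]
              omega
        · rw [Nat.cast_zero]
          by_cases hyU' : y ∈ U
          · have : y ∈ (Finset.univ.filter fun i : Fin n => i.1 < m).image q := by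
              by_contra h'
              exact hyU (Finset.mem_sdiff.2 ⟨hyU', h'⟩)
            obtain ⟨i, hi, rfl⟩ := Finset.mem_image.1 this
            have hi' : i.1 < m := by simpa using hi
            have hik : i ≠ k := by rintro rfl; simp [hk] at hi'
            exact (Φ.map_eq_zero_of_eq _ (i := i) (j := k) (by simp [hik, hi']) hik).symm
          · exact (hΦ k y hy hyU' _ (by simp)).symm
      rw [hsplit, Φ.map_update_add, Nat.cast_add, hD, hterm _ (Or.inl rfl), hterm _ (Or.inr rfl)]
  have := key n 0 (by omega) p (fun i hi => absurd hi (by omega)) (fun i j _ hj => absurd hj (by omega))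
  simpa using this

section Region

variable (a b c k l : ℕ)

/-- The positions `x` such that the lattice point `(x, s - x)` lies on the region. -/
noncomputable def positions (s : ℤ) : Finset ℤ :=
  (Finset.Icc 0 ((a : ℤ) + b + k)).filter fun x =>
    0 ≤ s - x ∧ s - x ≤ (b : ℤ) + c + k ∧ ¬((a : ℤ) + 1 ≤ x ∧ (b : ℤ) + c ≤ s - x)

/-- The positions of the up-triangles `(x, s - x)` of the region. -/
noncomputable def upPositions (s : ℤ) : Finset ℤ :=
  if s = b + l then (positions a b c k s).erase 0 else positions a b c k s

/-- The part of the region that lies beyond the line `x + y = s + 1`. -/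
def upperPart (s : ℤ) : Set Tri :=
  {τ | if τ.2.2 then s + 1 ≤ τ.1 + τ.2.1 ∧ τ.1 + τ.2.1 ≤ (a : ℤ) + b + c + k ∧
      τ.1 ∈ upPositions a b c k l (τ.1 + τ.2.1)
    else s ≤ τ.1 + τ.2.1 ∧ τ.1 + τ.2.1 ≤ (a : ℤ) + b + c + k - 1 ∧
      τ.1 ∈ positions a b c k (τ.1 + τ.2.1)}

/-- The positions of the end points of the lattice paths. -/
def sinkPos : Fin (b + 1) → ℤ :=
  Fin.cons (a : ℤ) fun j : Fin b => (a : ℤ) + k + 1 + j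

/-- The numbers of lattice paths with `N` steps from the position `x` to the sinks. -/
def pathRow (N : ℕ) (x : ℤ) : Fin (b + 1) → ℚ := fun j =>
  if x ≤ sinkPos a b k j then (N.choose (sinkPos a b k j - x).toNat : ℚ) else 0

variable {a b c k l}

lemma mem_positions {s x : ℤ} : x ∈ positions a b c k s ↔
    (0 ≤ x ∧ x ≤ (a : ℤ) + b + k) ∧ 0 ≤ s - x ∧ s - x ≤ (b : ℤ) + c + k ∧
      ¬((a : ℤ) + 1 ≤ x ∧ (b : ℤ) + c ≤ s - x) := by
  simp [positions]

lemma upPositions_subset (s : ℤ) : upPositions a b c k l s ⊆ positions a b c k s := by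
  unfold upPositions
  split_ifs
  · exact Finset.erase_subset _ _
  · exact subset_rfl

lemma mem_upPositions {s x : ℤ} : x ∈ upPositions a b c k l s ↔
    x ∈ positions a b c k s ∧ ¬(s = b + l ∧ x = 0) := by
  unfold upPositions
  split_ifs with h
  · simp [h, and_comm]
  · simp [h]

lemma beyond_upperPart (s : ℤ) : Beyond (upperPart a b c k l s) s := by
  rintro ⟨x, y, e⟩ h
  cases e
  · exact h.1
  · exact h.1

lemma finite_upperPart (s : ℤ) : (upperPart a b c k l s).Finite := by
  refine ((Set.finite_Icc (0 : ℤ) (a + b + k)).prod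
    ((Set.finite_Icc (0 : ℤ) (b + c + k)).prod (Set.finite_univ (α := Bool)))).subset ?_
  rintro ⟨x, y, e⟩ h
  have hx : x ∈ positions a b c k (x + y) := by
    cases e
    · exact h.2.2
    · exact upPositions_subset _ h.2.2
  rw [mem_positions] at hx
  simp only [Set.mem_prod, Set.mem_Icc, Set.mem_univ, and_true]
  omega

lemma hexDentB_eq_upperPart : HexDentB a b c k l = upperPart a b c k l (b - 1) := by
  ext ⟨x, y, e⟩
  cases e
  · simp only [HexDentB, HexK, BigTri, upperPart, mem_positions, Set.mem_sdiff, Set.mem_ofPred_eq,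
      Set.mem_union, Set.mem_singleton_iff, Prod.mk.injEq, Bool.false_eq_true, if_false, and_false,
      false_or]
    push_cast
    omega
  · simp only [HexDentB, HexK, BigTri, upperPart, mem_upPositions, mem_positions, Set.mem_sdiff,
      Set.mem_ofPred_eq, Set.mem_union, Set.mem_singleton_iff, Prod.mk.injEq, if_true, and_true]
    push_cast
    omega

lemma upperPart_diff {s : ℤ} (hs : s ≤ (a : ℤ) + b + c + k - 1) (W P : Finset ℤ)
    (hP : ∀ x, x ∈ P ↔ x ∈ positions a b c k s ∧ x ∉ W) :
    upperPart a b c k l s \ {τ | τ.2.2 = false ∧ τ.1 ∈ W ∧ τ.1 + τ.2.1 = s} =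
      stripRegion (upperPart a b c k l (s + 1)) (s + 1) P (upPositions a b c k l (s + 1)) := by
  ext ⟨x, y, e⟩
  cases e
  · rw [mem_stripRegion_down, hP]
    simp only [upperPart, Set.mem_sdiff, Set.mem_ofPred_eq, Bool.false_eq_true, if_false, true_and]
    constructor
    · rintro ⟨⟨h1, h2, h3⟩, h4⟩
      by_cases h : x + y = s
      · exact Or.inr ⟨⟨h ▸ h3, fun hx => h4 ⟨hx, h⟩⟩, by omega⟩
      · exact Or.inl ⟨by omega, h2, h3⟩
    · rintro (⟨h1, h2, h3⟩ | ⟨⟨h1, h2⟩, h3⟩)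
      · exact ⟨⟨by omega, h2, h3⟩, by omega⟩
      · obtain rfl : s = x + y := by omega
        exact ⟨⟨le_rfl, hs, h1⟩, fun h => h2 h.1⟩
  · rw [mem_stripRegion_up]
    simp only [upperPart, Set.mem_sdiff, Set.mem_ofPred_eq, if_true, reduceCtorEq, false_and,
      not_false_eq_true, and_true]
    constructor
    · rintro ⟨h1, h2, h3⟩
      by_cases h : x + y = s + 1
      · exact Or.inr ⟨h ▸ h3, h⟩
      · exact Or.inl ⟨by omega, h2, h3⟩
    · rintro (⟨h1, h2, h3⟩ | ⟨h1, h2⟩)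
      · exact ⟨by omega, h2, h3⟩
      · rw [h2]
        exact ⟨le_rfl, by omega, h1⟩

lemma strictMono_sinkPos : StrictMono (sinkPos a b k) := by
  refine Fin.strictMono_iff_lt_succ.2 fun i => ?_
  cases b with
  | zero => exact i.elim0
  | succ b =>
    refine Fin.cases ?_ (fun i => ?_) i
    · simp [sinkPos]
    · rw [← Fin.succ_castSucc]
      simp [sinkPos, Fin.cons_succ]

lemma sinkPos_cases (j : Fin (b + 1)) : sinkPos a b k j = a ∨
    ((a : ℤ) + k + 1 ≤ sinkPos a b k j ∧ sinkPos a b k j ≤ (a : ℤ) + k + b) := by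
  refine Fin.cases (Or.inl rfl) (fun j => Or.inr ?_) j
  have := j.2
  simp only [sinkPos, Fin.cons_succ]
  omega

lemma image_sinkPos : Finset.univ.image (sinkPos a b k) =
    positions a b c k ((a : ℤ) + b + c + k) := by
  ext x
  simp only [Finset.mem_image, Finset.mem_univ, true_and, mem_positions]
  constructor
  · rintro ⟨j, rfl⟩
    have := sinkPos_cases (a := a) (k := k) j
    omega
  · intro h
    by_cases hx : x = a
    · exact ⟨0, hx.symm⟩
    · refine ⟨Fin.succ ⟨(x - a - k - 1).toNat, by omega⟩, ?_⟩
      simp only [sinkPos, Fin.cons_succ]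
      omega

lemma pathRow_succ (N : ℕ) (x : ℤ) :
    pathRow a b k (N + 1) x = pathRow a b k N x + pathRow a b k N (x + 1) := by
  ext j
  simp only [pathRow, Pi.add_apply]
  rcases lt_trichotomy x (sinkPos a b k j) with h | h | h
  · rw [if_pos h.le, if_pos h.le, if_pos (by omega)]
    obtain ⟨m, hm⟩ : ∃ m : ℕ, sinkPos a b k j - x = m + 1 :=
      ⟨(sinkPos a b k j - x - 1).toNat, by omega⟩
    have h1 : (sinkPos a b k j - x).toNat = m + 1 := by omega
    have h2 : (sinkPos a b k j - (x + 1)).toNat = m := by omega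
    rw [h1, h2, Nat.choose_succ_succ]
    push_cast
    ring
  · rw [if_pos h.le, if_pos h.le, if_neg (by omega), h]
    simp
  · rw [if_neg (by omega), if_neg (by omega), if_neg (by omega), add_zero]

lemma pathRow_eq_zero {N : ℕ} {x : ℤ} (hx0 : 0 ≤ x) (hxs : x ≤ (a : ℤ) + b + c + k - N)
    (hx : x ∉ positions a b c k ((a : ℤ) + b + c + k - N)) : pathRow a b k N x = 0 := by
  rw [mem_positions] at hx
  ext j
  have := sinkPos_cases (a := a) (k := k) j
  simp only [pathRow, Pi.zero_apply, ite_eq_right_iff, Nat.cast_eq_zero]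
  intro hj
  refine Nat.choose_eq_zero_of_lt ?_
  omega

lemma pathRow_zero_sinkPos :
    Matrix.of (fun i : Fin (b + 1) => pathRow a b k 0 (sinkPos a b k i)) = 1 := by
  ext i j
  simp only [Matrix.of_apply, pathRow, Matrix.one_apply]
  rcases lt_trichotomy i j with h | rfl | h
  · have := strictMono_sinkPos (a := a) (k := k) h
    rw [if_pos this.le, if_neg h.ne, Nat.choose_eq_zero_of_lt (by omega), Nat.cast_zero]
  · simp
  · have := strictMono_sinkPos (a := a) (k := k) h
    rw [if_neg (by omega), if_neg h.ne']

/-- Transfer of an alternating expression across one strip of the region. -/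
lemma M_stripRegion_upperPart {n N : ℕ} {s : ℤ} (hs : s = (a : ℤ) + b + c + k - N)
    (Φ : (Fin (b + 1) → ℚ) [⋀^Fin n]→ₗ[ℚ] ℚ)
    (hΦ : s = b + l → ∀ i, ∀ v : Fin n → Fin (b + 1) → ℚ, v i = pathRow a b k N 0 → Φ v = 0)
    (h : ∀ q : Fin n → ℤ, StrictMono q → (∀ i, q i ∈ upPositions a b c k l s) →
      (M (stripRegion (upperPart a b c k l s) s ∅
        (upPositions a b c k l s \ Finset.univ.image q)) : ℚ) = Φ fun i => pathRow a b k N (q i))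
    (p : Fin n → ℤ) (hp : StrictMono p) (hpV : ∀ i, p i ∈ positions a b c k (s - 1)) :
    (M (stripRegion (upperPart a b c k l s) s (Finset.univ.image p)
      (upPositions a b c k l s)) : ℚ) = Φ fun i => pathRow a b k (N + 1) (p i) := by
  rw [M_stripRegion_alternating (finite_upperPart s) (beyond_upperPart s) _ p hp
    (pathRow a b k N) Φ ?_ h]
  · simp only [pathRow_succ]
  · intro i x hx hxU v hv
    have hpi := mem_positions.1 (hpV i)
    rw [mem_upPositions] at hxU
    by_cases h0 : s = b + l ∧ x = 0
    · exact hΦ h0.1 i v (h0.2 ▸ hv)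
    · refine Φ.map_coord_zero i (hv.trans (pathRow_eq_zero (c := c) (by omega) (by omega) ?_))
      rw [← hs]
      exact fun h' => hxU ⟨h', h0⟩

lemma M_stripRegion_empty {s : ℤ} (hs : s ≤ (a : ℤ) + b + c + k - 1)
    {n : ℕ} (q : Fin n → ℤ) (hq : ∀ i, q i ∈ positions a b c k s) :
    M (stripRegion (upperPart a b c k l s) s ∅ (positions a b c k s \ Finset.univ.image q)) =
      M (stripRegion (upperPart a b c k l (s + 1)) (s + 1) (Finset.univ.image q)
        (upPositions a b c k l (s + 1))) := by
  rw [M_stripRegion_holes (finite_upperPart s) (beyond_upperPart s),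
    upperPart_diff hs _ (Finset.univ.image q)]
  · intro x
    have : x ∈ Finset.univ.image q → x ∈ positions a b c k s := by
      intro hx
      obtain ⟨i, -, rfl⟩ := Finset.mem_image.1 hx
      exact hq i
    rw [Finset.mem_sdiff]
    tauto
  · intro u hu
    have hu' := (Finset.mem_sdiff.1 hu).1
    simp only [upperPart, Set.mem_ofPred_eq, Bool.false_eq_true, if_false]
    rw [add_sub_cancel]
    exact ⟨le_rfl, hs, hu'⟩

lemma M_stripRegion_above_dent (N : ℕ) (hN : (b : ℤ) + l ≤ (a : ℤ) + b + c + k - N)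
    (s : ℤ) (hs : s = (a : ℤ) + b + c + k - N)
    (q : Fin (b + 1) → ℤ) (hq : StrictMono q) (hqV : ∀ i, q i ∈ positions a b c k s) :
    (M (stripRegion (upperPart a b c k l s) s ∅
      (positions a b c k s \ Finset.univ.image q)) : ℚ) =
      Matrix.detRowAlternating fun i => pathRow a b k N (q i) := by
  induction N generalizing s q with
  | zero =>
    obtain rfl : s = (a : ℤ) + b + c + k := by rw [hs]; simp
    rw [← image_sinkPos] at hqV ⊢
    have hcard : (Finset.univ.image (sinkPos a b k)).card = b + 1 := by
      rw [Finset.card_image_of_injective _ strictMono_sinkPos.injective, Finset.card_fin]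
    have hqs : q = sinkPos a b k := by
      rw [Finset.orderEmbOfFin_unique hcard hqV hq, ← Finset.orderEmbOfFin_unique hcard
        (fun i => Finset.mem_image_of_mem _ (Finset.mem_univ i)) strictMono_sinkPos]
    have hempty : stripRegion (upperPart a b c k l ((a : ℤ) + b + c + k))
        ((a : ℤ) + b + c + k) ∅ ∅ = ∅ := by
      ext ⟨x, y, e⟩
      cases e
      · simp only [mem_stripRegion_down, upperPart, Set.mem_ofPred_eq, Bool.false_eq_true, if_false,
          Finset.notMem_empty, false_and, or_false, Set.mem_empty_iff_false, iff_false]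
        omega
      · simp only [mem_stripRegion_up, upperPart, Set.mem_ofPred_eq, if_true,
          Finset.notMem_empty, false_and, or_false, Set.mem_empty_iff_false, iff_false]
        omega
    rw [hqs, Finset.sdiff_self, hempty, M_empty, Nat.cast_one]
    exact ((congrArg Matrix.det pathRow_zero_sinkPos).trans Matrix.det_one).symm
  | succ N ih =>
    push_cast at hN hs
    have hU : upPositions a b c k l (s + 1) = positions a b c k (s + 1) :=
      if_neg (by omega)
    rw [M_stripRegion_empty (by omega) q hqV]
    refine M_stripRegion_upperPart (by omega) _ (by omega) ?_ q hq (by simpa using hqV)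
    intro q' hq' hqU'
    rw [hU] at hqU' ⊢
    exact ih (by omega) (s + 1) (by omega) q' hq' hqU'

lemma M_stripRegion_below_dent (hl : l ≤ c + k) (r : ℕ) (s : ℤ) (hs : s = (b : ℤ) + l - r)
    (hr : r ≤ l) (q : Fin b → ℤ) (hq : StrictMono q)
    (hqU : ∀ i, q i ∈ upPositions a b c k l s) :
    (M (stripRegion (upperPart a b c k l s) s ∅
      (upPositions a b c k l s \ Finset.univ.image q)) : ℚ) =
      Matrix.detRowAlternating.curryLeft (pathRow a b k (a + c + k - l) 0) fun i =>
        pathRow a b k (a + c + k - l + r) (q i) := by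
  induction r generalizing s q with
  | zero =>
    obtain rfl : s = (b : ℤ) + l := by simpa using hs
    have hq0 : ∀ i, 0 < q i := fun i => by
      have h := mem_upPositions.1 (hqU i)
      have := (mem_positions.1 h.1).1.1
      have := h.2
      omega
    have hset : upPositions a b c k l (b + l) \ Finset.univ.image q =
        positions a b c k (b + l) \ Finset.univ.image (Fin.cons 0 q : Fin (b + 1) → ℤ) := by
      ext x
      simp only [Finset.mem_sdiff, mem_upPositions, Finset.mem_image, Finset.mem_univ, true_and,
        Fin.exists_fin_succ, Fin.cons_zero, Fin.cons_succ]
      grind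
    rw [hset, M_stripRegion_above_dent (a + c + k - l) (by omega) _ (by omega)]
    · simp only [AlternatingMap.curryLeft_apply_apply, add_zero]
      congr 1
      ext i
      refine Fin.cases ?_ (fun i => ?_) i <;> simp [Matrix.vecCons]
    · refine Fin.strictMono_iff_lt_succ.2 fun i => ?_
      rw [Fin.cons_succ]
      cases b with
      | zero => exact i.elim0
      | succ b =>
        refine Fin.cases (by simpa using hq0 0) (fun j => ?_) i
        rw [← Fin.succ_castSucc, Fin.cons_succ]
        exact hq (Fin.castSucc_lt_succ)
    · intro i
      refine Fin.cases ?_ (fun i => ?_) i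
      · rw [Fin.cons_zero, mem_positions]
        omega
      · rw [Fin.cons_succ]
        exact upPositions_subset _ (hqU i)
  | succ r ih =>
    push_cast at hs
    have hU : upPositions a b c k l s = positions a b c k s := if_neg (by omega)
    rw [hU] at hqU ⊢
    rw [M_stripRegion_empty (by omega) q hqU]
    refine M_stripRegion_upperPart (N := a + c + k - l + r) (by omega) _ ?_
      (ih (s + 1) (by omega) (by omega)) q hq (by simpa using hqU)
    intro h i v hv
    obtain rfl : r = 0 := by omega
    rw [AlternatingMap.curryLeft_apply_apply]
    exact AlternatingMap.map_eq_zero_of_eq _ _ (i := 0) (j := i.succ) (by simpa using hv.symm)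
      (Fin.succ_ne_zero i).symm

/-- The number of tilings as a determinant of binomial coefficients. -/
lemma M_hexDentB_eq_det (hl : l ≤ c + k) : (M (HexDentB a b c k l) : ℚ) =
    Matrix.det (Matrix.of (Fin.cons (pathRow a b k (a + c + k - l) 0)
      fun i : Fin b => pathRow a b k (a + c + k + 1) i)) := by
  have hinit : upperPart a b c k l (b - 1) = stripRegion (upperPart a b c k l b) b
      (Finset.univ.image fun i : Fin b => ((i : ℕ) : ℤ)) (upPositions a b c k l b) := by
    have := upperPart_diff (a := a) (b := b) (c := c) (k := k) (l := l) (s := b - 1) (by omega) ∅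
      (Finset.univ.image fun i : Fin b => ((i : ℕ) : ℤ)) ?_
    · simpa using this
    · intro x
      simp only [Finset.mem_image, Finset.mem_univ, true_and, mem_positions, Finset.notMem_empty,
        not_false_eq_true, and_true]
      constructor
      · rintro ⟨i, rfl⟩
        have := i.2
        omega
      · intro h
        exact ⟨⟨x.toNat, by omega⟩, by simp; omega⟩
  rw [hexDentB_eq_upperPart, hinit, M_stripRegion_upperPart (N := a + c + k) (by push_cast; ring)
    (Matrix.detRowAlternating.curryLeft (pathRow a b k (a + c + k - l) 0))]
  · rfl
  · intro h i v hv
    obtain rfl : l = 0 := by omega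
    rw [AlternatingMap.curryLeft_apply_apply]
    exact AlternatingMap.map_eq_zero_of_eq _ _ (i := 0) (j := i.succ) (by simpa using hv.symm)
      (Fin.succ_ne_zero i).symm
  · intro q hq hqU
    have := M_stripRegion_below_dent hl l b (by ring) le_rfl q hq hqU
    rwa [Nat.sub_add_cancel (by omega)] at this
  · intro i j hij
    simpa using hij
  · intro i
    have := i.2
    rw [mem_positions]
    omega

end Region

section RisingFactorial

open Finset Polynomial

lemma rF_sub_add_one (x : ℚ) (n : ℕ) : rF (x - n + 1) n = (descPochhammer ℚ n).eval x := by
  rw [descPochhammer_eval_eq_prod_range, rF, ← prod_range_reflect]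
  refine prod_congr rfl fun i hi => ?_
  have hi := mem_range.1 hi
  have h : ((n - 1 - i : ℕ) : ℚ) = n - 1 - i := by
    rw [Nat.cast_sub (by omega), Nat.cast_sub (by omega), Nat.cast_one]
  rw [h]
  ring

lemma descPochhammer_eval_add (x y : ℚ) (n : ℕ) :
    (descPochhammer ℚ n).eval (x + y) = ∑ j ∈ range (n + 1),
      (n.choose j : ℚ) * ((descPochhammer ℚ j).eval x * (descPochhammer ℚ (n - j)).eval y) := by
  have h : ∀ (m : ℕ) (z : ℚ), (descPochhammer ℤ m).smeval z = (descPochhammer ℚ m).eval z := by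
    intro m z
    rw [← aeval_eq_smeval, aeval_def, ← eval_map, descPochhammer_map]
  have := Ring.descPochhammer_smeval_add (r := x) (s := y) n (Commute.all x y)
  simp only [h] at this
  rw [this, Nat.sum_antidiagonal_eq_sum_range_succ_mk]

lemma descPochhammer_eval_add_index (x : ℚ) (n m : ℕ) :
    (descPochhammer ℚ (n + m)).eval x =
      (descPochhammer ℚ n).eval x * (descPochhammer ℚ m).eval (x - n) := by
  rw [← descPochhammer_mul, eval_mul, eval_comp]
  simp

lemma rF_neg_self (i : ℕ) : rF (-(i : ℚ)) i = (-1) ^ i * (i.factorial : ℚ) := by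
  have h := rF_sub_add_one (-1) i
  rw [show (-1 : ℚ) - i + 1 = -i by ring] at h
  have h1 : (-1 : ℚ) ^ i = ∏ _j ∈ range i, (-1 : ℚ) := by simp
  rw [h, descPochhammer_eval_eq_prod_range, ← prod_range_add_one_eq_factorial, Nat.cast_prod, h1,
    ← prod_mul_distrib]
  exact prod_congr rfl fun j _ => by push_cast; ring

lemma rF_one (n : ℕ) : rF 1 n = (n.factorial : ℚ) := by
  rw [rF, ← prod_range_add_one_eq_factorial, Nat.cast_prod]
  exact prod_congr rfl fun j _ => by push_cast; ring

lemma rF_natCast_add_one (n m : ℕ) : rF ((n : ℚ) + 1) m * n.factorial = (n + m).factorial := by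
  induction m with
  | zero => simp [rF]
  | succ m ih =>
    rw [rF, prod_range_succ, ← rF, ← add_assoc, Nat.factorial_succ]
    push_cast
    rw [← ih]
    ring

lemma rF_natCast_add_one' (n m : ℕ) :
    rF ((n : ℚ) + 1) m = (n + m).factorial / n.factorial := by
  rw [eq_div_iff (by positivity), rF_natCast_add_one]

/-- The polynomial in `e` with value `(-e)_i (-e+i+1)_{k-i}`. -/
lemma exists_polynomial_rF (i k : ℕ) (hi : i ≤ k) : ∃ P : ℚ[X], P.degree < (k + 1 : ℕ) ∧
    ∀ e : ℚ, P.eval e = rF (-e) i * rF (-e + i + 1) (k - i) := by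
  refine ⟨(∏ t ∈ range i, (-X + C (t : ℚ))) * ∏ t ∈ range (k - i), (-X + C ((i : ℚ) + 1 + t)),
    ?_, ?_⟩
  · refine lt_of_le_of_lt degree_le_natDegree (Nat.cast_lt.2 (Nat.lt_succ_of_le ?_))
    have h : ∀ (n : ℕ) (f : ℕ → ℚ), (∏ t ∈ range n, (-X + C (f t))).natDegree ≤ n := fun n f => by
      refine (natDegree_prod_le _ _).trans ((sum_le_sum fun t _ => ?_).trans
        (by simp : ∑ t ∈ range n, 1 ≤ n))
      compute_degree
    exact natDegree_mul_le.trans ((add_le_add (h i _) (h (k - i) _)).trans (by omega))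
  · intro e
    simp only [eval_mul, eval_prod, eval_add, eval_neg, eval_X, eval_C, rF]
    congr 1
    exact prod_congr rfl fun t _ => by ring

lemma rF_mul_rF_eval (i k m : ℕ) (hi : i ≤ k) (hm : m ≤ k) :
    rF (-(m : ℚ)) i * rF (-(m : ℚ) + i + 1) (k - i) =
      if i = m then (-1) ^ m * (m.factorial : ℚ) * ((k - m).factorial : ℚ) else 0 := by
  split_ifs with h
  · subst h
    rw [rF_neg_self, neg_add_cancel, zero_add, rF_one]
  · rcases lt_or_gt_of_ne h with h | h
    · rw [mul_eq_zero]
      right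
      refine prod_eq_zero (i := m - i - 1) (mem_range.2 (by omega)) ?_
      rw [Nat.cast_sub (by omega), Nat.cast_sub (by omega)]
      push_cast
      ring
    · rw [mul_eq_zero]
      left
      exact prod_eq_zero (mem_range.2 h) (by simp)

/-- Lagrange interpolation at `0, ..., k` of the right-hand side as a polynomial in `e`. -/
lemma sum_rF_eq_sum_descPochhammer (b k : ℕ) (l e : ℚ) :
    ∑ i ∈ range (k + 1), (-1 : ℚ) ^ i / ((i.factorial : ℚ) * ((k - i).factorial : ℚ)) *
        (descPochhammer ℚ (k - i)).eval l * rF (l + b + 1) i *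
        (rF (-e) i * rF (-e + i + 1) (k - i)) =
      ∑ j ∈ range (k + 1), (descPochhammer ℚ (k - j)).eval l *
        (descPochhammer ℚ j).eval ((b : ℚ) + k) / (j.factorial : ℚ) *
        (descPochhammer ℚ j).eval e := by
  choose! P hPdeg hP using fun i => exists_polynomial_rF i k
  set L : ℚ[X] := ∑ i ∈ range (k + 1),
    C ((-1 : ℚ) ^ i / ((i.factorial : ℚ) * ((k - i).factorial : ℚ)) *
      (descPochhammer ℚ (k - i)).eval l * rF (l + b + 1) i) * P i with hL
  set R : ℚ[X] := ∑ j ∈ range (k + 1), C ((descPochhammer ℚ (k - j)).eval l *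
    (descPochhammer ℚ j).eval ((b : ℚ) + k) / (j.factorial : ℚ)) * descPochhammer ℚ j with hR
  have hdeg : ∀ (f : ℕ → ℚ) (Q : ℕ → ℚ[X]), (∀ i ≤ k, (Q i).degree < (k + 1 : ℕ)) →
      (∑ i ∈ range (k + 1), C (f i) * Q i).degree < (k + 1 : ℕ) := by
    intro f Q hQ
    refine (degree_sum_le _ _).trans_lt ((Finset.sup_lt_iff (WithBot.bot_lt_coe _)).2 fun i hi => ?_)
    refine lt_of_le_of_lt ?_ (hQ i (Nat.lt_succ_iff.1 (mem_range.1 hi)))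
    rw [← smul_eq_C_mul]
    exact degree_smul_le _ _
  have hcard : ((range (k + 1)).image fun m : ℕ => (m : ℚ)).card = k + 1 := by
    rw [card_image_of_injective _ Nat.cast_injective, card_range]
  have hLR : L = R := by
    refine eq_of_degrees_lt_of_eval_finset_eq ((range (k + 1)).image fun m : ℕ => (m : ℚ)) ?_ ?_ ?_
    · rw [hcard]
      exact hdeg _ _ hPdeg
    · rw [hcard]
      refine hdeg _ _ fun i hi => ?_
      refine degree_le_natDegree.trans_lt ?_
      rw [descPochhammer_natDegree]
      exact Nat.cast_lt.2 (Nat.lt_succ_of_le hi)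
    · intro x hx
      obtain ⟨m, hm, rfl⟩ := mem_image.1 hx
      have hm : m ≤ k := Nat.lt_succ_iff.1 (mem_range.1 hm)
      have h1 : L.eval (m : ℚ) = (descPochhammer ℚ (k - m)).eval l * rF (l + b + 1) m := by
        rw [hL, eval_finsetSum, sum_eq_single m]
        · rw [eval_mul, eval_C, hP m hm, rF_mul_rF_eval m k m hm hm, if_pos rfl]
          have h2 : ((-1 : ℚ) ^ m) * (-1) ^ m = 1 := by rw [← mul_pow]; simp
          field_simp
          linear_combination ((descPochhammer ℚ (k - m)).eval l * rF (l + b + 1) m) * h2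
        · intro i hi him
          have hi : i ≤ k := Nat.lt_succ_iff.1 (mem_range.1 hi)
          rw [eval_mul, hP i hi, rF_mul_rF_eval i k m hi hm, if_neg him, mul_zero]
        · intro h
          exact absurd (mem_range.2 (Nat.lt_succ_of_le hm)) h
      have h2 : R.eval (m : ℚ) = (descPochhammer ℚ (k - m)).eval l *
          (descPochhammer ℚ m).eval (((b : ℚ) + k) + (l - (k - m : ℕ))) := by
        rw [descPochhammer_eval_add, hR, eval_finsetSum, mul_sum]
        rw [← sum_subset (range_subset_range.2 (Nat.succ_le_succ hm))]
        · refine sum_congr rfl fun j hj => ?_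
          have hj : j ≤ m := Nat.lt_succ_iff.1 (mem_range.1 hj)
          rw [eval_mul, eval_C, descPochhammer_eval_eq_descFactorial,
            Nat.descFactorial_eq_factorial_mul_choose, show k - j = (k - m) + (m - j) by omega,
            descPochhammer_eval_add_index]
          push_cast
          field_simp
        · intro j _ hj
          have hj : m < j := by simpa using hj
          rw [eval_mul, descPochhammer_eval_coe_nat_of_lt hj, mul_zero]
      rw [h1, h2, ← rF_sub_add_one _ m]
      congr 2
      rw [Nat.cast_sub hm]
      ring
  have h := congrArg (eval e) hLR
  rw [hL, hR, eval_finsetSum, eval_finsetSum] at h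
  simp only [eval_mul, eval_C] at h
  rw [← h]
  exact sum_congr rfl fun i hi => by rw [hP i (Nat.lt_succ_iff.1 (mem_range.1 hi))]

/-- The sum of products of binomial coefficients that counts the tilings up to a product. -/
def binomialSum (b c k l : ℕ) : ℚ :=
  ∑ i ∈ range (l + 1), (c.choose (l - i) : ℚ) * ((b + k).choose (b + i) : ℚ)

lemma binomialSum_eq (b c k l e : ℕ) (h : l + e = c + k) :
    (l.factorial : ℚ) * e.factorial * binomialSum b c k l = (c.factorial : ℚ) *
      ∑ j ∈ range (k + 1), (descPochhammer ℚ (k - j)).eval (l : ℚ) *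
        (descPochhammer ℚ j).eval ((b : ℚ) + k) / (j.factorial : ℚ) *
        (descPochhammer ℚ j).eval (e : ℚ) := by
  have h1 : binomialSum b c k l = ∑ i ∈ range (k + 1),
      if i ≤ l then (c.choose (l - i) : ℚ) * ((b + k).choose (b + i) : ℚ) else 0 := by
    rw [binomialSum, ← sum_filter]
    have h2 : ∀ i ∈ range (l + 1), i ∉ (range (k + 1)).filter (· ≤ l) →
        (c.choose (l - i) : ℚ) * ((b + k).choose (b + i) : ℚ) = 0 := by
      intro i hi hi'
      simp at hi hi'
      rw [Nat.choose_eq_zero_of_lt (n := b + k) (by omega), Nat.cast_zero, mul_zero]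
    refine (sum_subset ?_ h2).symm
    intro i hi
    simp at hi ⊢
    omega
  rw [h1, ← sum_range_reflect, mul_sum, mul_sum]
  refine sum_congr rfl fun j hj => ?_
  have hj : j ≤ k := Nat.lt_succ_iff.1 (mem_range.1 hj)
  have hbk : (b + k).choose (b + (k + 1 - 1 - j)) = (b + k).choose j :=
    Nat.choose_symm_of_eq_add (by omega)
  rw [hbk, ← Nat.cast_add b k, descPochhammer_eval_eq_descFactorial,
    descPochhammer_eval_eq_descFactorial, descPochhammer_eval_eq_descFactorial,
    Nat.descFactorial_eq_factorial_mul_choose (b + k)]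
  simp only [Nat.add_sub_cancel]
  split_ifs with hle
  · have key : l.factorial * e.factorial * c.choose (l - (k - j)) =
        c.factorial * l.descFactorial (k - j) * e.descFactorial j := by
      by_cases hej : j ≤ e
      · have h3 := Nat.choose_mul_factorial_mul_factorial (n := c) (k := l - (k - j)) (by omega)
        have h4 := Nat.factorial_mul_descFactorial hle
        have h5 := Nat.factorial_mul_descFactorial hej
        rw [show c - (l - (k - j)) = e - j by omega] at h3
        rw [← h3, ← h4, ← h5]
        ring
      · rw [Nat.choose_eq_zero_of_lt (by omega), Nat.descFactorial_of_lt (not_le.1 hej),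
          mul_zero, mul_zero]
    have key' : (l.factorial : ℚ) * e.factorial * c.choose (l - (k - j)) =
        c.factorial * l.descFactorial (k - j) * e.descFactorial j := by exact_mod_cast key
    rw [← mul_assoc, key']
    push_cast
    field_simp
  · rw [Nat.descFactorial_of_lt (not_le.1 hle)]
    simp

lemma prod_pow_min_eq (p q : ℕ) (x : ℚ) :
    ∏ t ∈ Icc 1 (p + q - 1), (x + t) ^ min t (min (min p q) (p + q - t)) =
      ∏ i ∈ range p, ∏ j ∈ range q, (x + i + j + 1) := by
  rw [← prod_product' (f := fun i j : ℕ => x + i + j + 1),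
    ← prod_fiberwise_of_maps_to (t := Icc 1 (p + q - 1)) (g := fun y : ℕ × ℕ => y.1 + y.2 + 1)]
  · refine prod_congr rfl fun t ht => ?_
    have ht := mem_Icc.1 ht
    have hcard : #{y ∈ range p ×ˢ range q | y.1 + y.2 + 1 = t} =
        min t (min (min p q) (p + q - t)) := by
      have : {y ∈ range p ×ˢ range q | y.1 + y.2 + 1 = t} =
          (Ico (t - q) (min p t)).image fun i => (i, t - 1 - i) := by
        ext ⟨i, j⟩
        simp only [mem_filter, mem_product, mem_range, mem_image, mem_Ico, Prod.mk.injEq]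
        constructor
        · intro h
          exact ⟨i, by omega, rfl, by omega⟩
        · rintro ⟨i', h, rfl, rfl⟩
          omega
      rw [this, card_image_of_injective _ fun i j h => (Prod.ext_iff.1 h).1, Nat.card_Ico]
      omega
    rw [← hcard, ← prod_const]
    refine prod_congr rfl fun y hy => ?_
    rw [← (mem_filter.1 hy).2]
    push_cast
    ring
  · intro y hy
    simp only [mem_product, mem_range] at hy
    simp only [mem_Icc]
    omega

lemma rFac_eq (b k c : ℕ) :
    rFac b k c = (∏ j ∈ range b, rF ((c : ℚ) + 1 + j) k) / rF ((c : ℚ) + 1) k := by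
  unfold rFac
  have h0 : rF ((c : ℚ) + 1) k ≠ 0 := by
    rw [rF_natCast_add_one']
    positivity
  split_ifs with hb
  · simp [hb]
  · obtain ⟨b, rfl⟩ := Nat.exists_eq_succ_of_ne_zero hb
    rw [eq_div_iff h0, prod_range_succ', Nat.cast_zero, add_zero]
    congr 1
    have h := prod_pow_min_eq b k ((c : ℚ) + 1)
    rw [show b.succ + k - 2 = b + k - 1 by omega, show b.succ - 1 = b by omega]
    rw [show b.succ + k - 1 = b + k by omega, h]
    refine prod_congr rfl fun i _ => prod_congr rfl fun j _ => ?_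
    push_cast
    ring

lemma prod_factorial_div_telescope (a b c k : ℕ) :
    (∏ j ∈ range b, ((c + k + j).factorial : ℚ) / (c + j).factorial) *
      (∏ j ∈ range b, ((a + c + k + 1 + j).factorial : ℚ) / (c + k + 1 + j).factorial) =
      (∏ j ∈ range b, ((a + c + k + 1 + j).factorial : ℚ) / (c + j).factorial) *
        ((c + k).factorial / (b + c + k).factorial) := by
  rw [← prod_mul_distrib]
  induction b with
  | zero =>
    have : ((c + k).factorial : ℚ) ≠ 0 := by positivity
    simp [this]
  | succ b ih =>
    rw [prod_range_succ, prod_range_succ, ih, show b + 1 + c + k = c + k + 1 + b by ring,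
      show b + c + k = c + k + b by ring]
    field_simp

lemma qPoly_eq (a b c k l : ℕ) (hl : l ≤ c + k) : qPoly a b k c l =
    (∏ j ∈ range b, ((a + c + k + 1 + j).factorial : ℚ) / (c + j).factorial) *
      ((b + l).factorial * (a + (c + k - l)).factorial / (b + c + k).factorial) *
      binomialSum b c k l := by
  obtain ⟨e, he⟩ := Nat.exists_eq_add_of_le hl
  have hce : (c : ℚ) + k - l = e := by
    rw [sub_eq_iff_eq_add', ← Nat.cast_add, he, Nat.cast_add]
  have hsum : ∑ i ∈ Icc 1 (k + 1),
      (-1 : ℚ) ^ (i - 1) / ((Nat.factorial (i - 1) : ℚ) * (Nat.factorial (k + 1 - i) : ℚ)) *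
        rF ((l : ℚ) - k + i) (k + 1 - i) * rF ((l : ℚ) + b + 1) (i - 1) *
        rF ((l : ℚ) - k - c) (i - 1) * rF ((l : ℚ) - k - c + i) (k + 1 - i) =
      (l.factorial : ℚ) * e.factorial * binomialSum b c k l / c.factorial := by
    rw [binomialSum_eq b c k l e he.symm, mul_div_cancel_left₀ _ (by positivity),
      ← sum_rF_eq_sum_descPochhammer]
    symm
    refine sum_nbij (· + 1) (fun i hi => ?_) (fun i _ j _ h => by simpa using h) (fun i hi => ?_)
      fun i hi => ?_
    · simp only [mem_range] at hi
      simp only [mem_Icc]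
      omega
    · simp only [coe_Icc, Set.mem_Icc] at hi
      simp only [coe_range, Set.mem_image, Set.mem_Iio]
      exact ⟨i - 1, by omega, by omega⟩
    · have hi : i ≤ k := Nat.lt_succ_iff.1 (mem_range.1 hi)
      have hlk : (l : ℚ) - k - c = -e := by rw [← hce]; ring
      rw [← rF_sub_add_one, Nat.add_sub_cancel, Nat.add_sub_add_right, hlk, Nat.cast_sub hi]
      push_cast
      rw [show (l : ℚ) - (k - i) + 1 = l - k + (i + 1) by ring, ← add_assoc (-(e : ℚ))]
      ring
  have hP : ∏ t ∈ Icc 1 (max a b + min a b - 1),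
      ((c : ℚ) + k + 1 + t) ^ min t (min (min a b) (max a b + min a b - t)) =
      ∏ j ∈ range b, ((a + c + k + 1 + j).factorial : ℚ) / (c + k + 1 + j).factorial := by
    rw [max_add_min, min_comm a b, add_comm a b, prod_pow_min_eq b a]
    refine prod_congr rfl fun j _ => ?_
    have := rF_natCast_add_one' (c + k + 1 + j) a
    rw [show a + c + k + 1 + j = c + k + 1 + j + a by ring, ← this, rF]
    refine prod_congr rfl fun t _ => ?_
    push_cast
    ring
  have hr : rFac b k c = (∏ j ∈ range b, ((c + k + j).factorial : ℚ) / (c + j).factorial) *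
      ((c.factorial : ℚ) / (c + k).factorial) := by
    rw [rFac_eq, rF_natCast_add_one', div_eq_mul_inv, inv_div]
    congr 1
    refine prod_congr rfl fun j _ => ?_
    have := rF_natCast_add_one' (c + j) k
    rw [show c + k + j = c + j + k by ring, ← this]
    push_cast
    congr 1
    ring
  have htel := prod_factorial_div_telescope a b c k
  rw [qPoly, hsum, hP, hr, hce, rF_natCast_add_one', rF_natCast_add_one', he,
    Nat.add_sub_cancel_left, add_comm l b, add_comm e a]
  rw [he] at htel
  have h1 : (l.factorial : ℚ) ≠ 0 := by positivity
  have h2 : (e.factorial : ℚ) ≠ 0 := by positivity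
  have h3 : (c.factorial : ℚ) ≠ 0 := by positivity
  have h4 : ((l + e).factorial : ℚ) ≠ 0 := by positivity
  generalize (∏ j ∈ range b, ((a + c + k + 1 + j).factorial : ℚ) / (c + j).factorial) = A at *
  generalize (∏ j ∈ range b, ((l + e + j).factorial : ℚ) / (c + j).factorial) = B at *
  generalize (∏ j ∈ range b, ((a + c + k + 1 + j).factorial : ℚ) /
    (l + e + 1 + j).factorial) = D at *
  field_simp at htel ⊢
  linear_combination binomialSum b c k l * htel

end RisingFactorial
section Determinant

open Finset

variable {a b c k l : ℕ}

lemma pathRow_add (N i : ℕ) (x : ℤ) : pathRow a b k (N + i) x =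
    ∑ j ∈ range (i + 1), i.choose j • pathRow a b k N (x + j) := by
  induction i generalizing x with
  | zero => simp
  | succ i ih =>
    rw [← add_assoc, pathRow_succ, ih, ih,
      sum_choose_succ_nsmul fun j _ => pathRow a b k N (x + (j : ℕ))]
    simp only [Nat.cast_add, Nat.cast_one, add_assoc, add_comm (1 : ℤ)]

lemma pathRow_add_natCast (N : ℕ) (i : Fin b) : pathRow a b k (N + i) 0 =
    ∑ j : Fin b, ((i : ℕ).choose j : ℚ) • pathRow a b k N j := by
  rw [pathRow_add, Fin.sum_univ_eq_sum_range
    (fun j => ((i : ℕ).choose j : ℚ) • pathRow a b k N (j : ℕ))]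
  simp only [Nat.cast_smul_eq_nsmul, zero_add]
  refine sum_subset (range_subset_range.2 i.2) fun j _ hj => ?_
  rw [Nat.choose_eq_zero_of_lt (by simpa using hj), zero_smul]

lemma pathRow_zero (N : ℕ) (j : Fin (b + 1)) : pathRow a b k N 0 j =
    (N.choose ((Fin.cons a fun j : Fin b => a + k + 1 + j : Fin (b + 1) → ℕ) j) : ℚ) := by
  refine Fin.cases ?_ (fun j => ?_) j
  · simp [pathRow, sinkPos]
  · have h : sinkPos a b k j.succ = (a + k + 1 + j : ℕ) := by simp [sinkPos]
    rw [pathRow, h, if_pos (by positivity), sub_zero, Int.toNat_natCast, Fin.cons_succ]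

/-- Unitriangular row operations move all starting points to the origin. -/
lemma det_pathRow_eq (v : Fin (b + 1) → ℚ) (N : ℕ) :
    Matrix.det (Matrix.of (Fin.cons v fun i : Fin b => pathRow a b k N i)) =
      Matrix.det (Matrix.of (Fin.cons v fun i : Fin b => pathRow a b k (N + i) 0)) := by
  set L : Matrix (Fin (b + 1)) (Fin (b + 1)) ℚ :=
    Matrix.of (Fin.cons (Fin.cons 1 0) fun i : Fin b => Fin.cons 0 fun j : Fin b =>
      ((i : ℕ).choose j : ℚ)) with hL
  have hdet : L.det = 1 := by
    rw [Matrix.det_of_isLowerTriangular]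
    · rw [Fin.prod_univ_succ]
      simp [hL]
    · intro i j
      refine Fin.cases ?_ (fun i => ?_) i <;> refine Fin.cases ?_ (fun j => ?_) j
      · simp
      · simp [hL]
      · simp [hL]
      · intro h
        have h : i < j := by simpa using h
        simp [hL, Nat.choose_eq_zero_of_lt h]
  rw [← one_mul (Matrix.det _), ← hdet, ← Matrix.det_mul]
  congr 1
  ext i j
  rw [Matrix.mul_apply, Fin.sum_univ_succ]
  refine Fin.cases ?_ (fun i => ?_) i
  · simp [hL]
  · simp [hL, pathRow_add_natCast]

lemma choose_sub_eq (X W s : ℕ) (hs : s ≤ X + W) : ((X + W - s).choose X : ℚ) =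
    ((X + W - s).factorial * s.factorial) * ((X.factorial * W.factorial : ℚ)⁻¹ * W.choose s) := by
  rcases le_or_gt s W with h | h
  · rw [Nat.cast_choose ℚ (by omega), Nat.cast_choose ℚ h, show X + W - s - X = W - s by omega]
    field_simp
  · rw [Nat.choose_eq_zero_of_lt (by omega), Nat.choose_eq_zero_of_lt h]
    simp

lemma cast_add_choose_eq (c y n m : ℕ) : ((c + y).choose (n + m) : ℚ) =
    ∑ s ∈ range n, (c.choose (m + 1 + s) : ℚ) * y.choose (n - 1 - s) +
      ∑ i ∈ range (m + 1), (c.choose (m - i) : ℚ) * y.choose (n + i) := by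
  have h : (c + y).choose (n + m) =
      ∑ s ∈ range (n + m + 1), c.choose (n + m - s) * y.choose s := by
    rw [add_comm c, Nat.add_choose_eq, Nat.sum_antidiagonal_eq_sum_range_succ
      fun i j => y.choose i * c.choose j]
    exact sum_congr rfl fun s _ => mul_comm _ _
  rw [h, add_assoc, sum_range_add, ← sum_range_reflect _ n]
  push_cast
  congr 1
  · refine sum_congr rfl fun s hs => ?_
    have := mem_range.1 hs
    rw [show n + m - (n - 1 - s) = m + 1 + s by omega]
  · exact sum_congr rfl fun s _ => by rw [Nat.add_sub_add_left]

lemma cast_add_choose_sub_eq (c y n i : ℕ) (hi : i < n) : ((c + y).choose (n - 1 - i) : ℚ) =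
    ∑ s ∈ range n, if i ≤ s then (c.choose (s - i) : ℚ) * y.choose (n - 1 - s) else 0 := by
  obtain ⟨d, rfl⟩ := Nat.exists_eq_add_of_lt hi
  have h : (c + y).choose d = ∑ s ∈ range (d + 1), c.choose s * y.choose (d - s) := by
    rw [Nat.add_choose_eq, Nat.sum_antidiagonal_eq_sum_range_succ
      fun i j => c.choose i * y.choose j]
  rw [add_assoc, sum_range_add, sum_eq_zero fun s hs => if_neg (not_le.2 (mem_range.1 hs)), zero_add,
    show i + (d + 1) - 1 - i = d by omega, h]
  push_cast
  refine sum_congr rfl fun s _ => ?_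
  rw [if_pos (Nat.le_add_right i s), Nat.add_sub_cancel_left,
    show i + (d + 1) - 1 - (i + s) = d - s by omega]

/-- The determinant of the binomial coefficients `C(c + Y_j, s_i)`. -/
lemma det_choose_eq_binomialSum : Matrix.det (Matrix.of fun i j : Fin (b + 1) =>
    ((c + (Fin.cons (b + k) fun j : Fin b => b - 1 - (j : ℕ) : Fin (b + 1) → ℕ) j).choose
      ((Fin.cons (b + l) fun i : Fin b => b - 1 - (i : ℕ) : Fin (b + 1) → ℕ) i) : ℚ)) =
    binomialSum b c k l := by
  set Y : Fin (b + 1) → ℕ := Fin.cons (b + k) fun j : Fin b => b - 1 - (j : ℕ) with hY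
  set A : Matrix (Fin (b + 1)) (Fin (b + 1)) ℚ :=
    Matrix.of (Fin.cons (Fin.cons 1 fun s : Fin b => (c.choose (l + 1 + s) : ℚ))
      fun i : Fin b => Fin.cons 0 fun s : Fin b => if i ≤ s then (c.choose (s - i : ℕ) : ℚ) else 0)
    with hA
  set B : Matrix (Fin (b + 1)) (Fin (b + 1)) ℚ :=
    Matrix.of (Fin.cons
      (fun j => ∑ i ∈ range (l + 1), (c.choose (l - i) : ℚ) * ((Y j).choose (b + i) : ℚ))
      fun s : Fin b => fun j => ((Y j).choose (b - 1 - s) : ℚ)) with hB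
  have hdetA : A.det = 1 := by
    rw [Matrix.det_of_isUpperTriangular]
    · rw [Fin.prod_univ_succ]
      simp [hA]
    · intro i j
      refine Fin.cases ?_ (fun i => ?_) i <;> refine Fin.cases ?_ (fun j => ?_) j
      · simp
      · simp [hA]
      · simp [hA]
      · intro h
        have h : j < i := by simpa using h
        simp [hA, h]
  have hdetB : B.det = binomialSum b c k l := by
    rw [Matrix.det_of_isLowerTriangular]
    · rw [Fin.prod_univ_succ]
      simp [hB, hY, binomialSum]
    · intro i j
      refine Fin.cases ?_ (fun i => ?_) i <;> refine Fin.cases ?_ (fun j => ?_) j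
      · simp
      · intro _
        have := j.2
        simp only [hB, hY, Matrix.of_apply, Fin.cons_zero, Fin.cons_succ]
        refine sum_eq_zero fun i _ => ?_
        rw [Nat.choose_eq_zero_of_lt (n := b - 1 - j) (by omega), Nat.cast_zero, mul_zero]
      · intro h
        exact absurd (show i.succ < 0 from h) (Fin.not_lt_zero _)
      · intro h
        have h : (i : ℕ) < j := by simpa using h
        have := j.2
        simp only [hB, hY, Matrix.of_apply, Fin.cons_succ]
        rw [Nat.choose_eq_zero_of_lt (by omega), Nat.cast_zero]
  rw [← hdetB, ← one_mul B.det, ← hdetA, ← Matrix.det_mul]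
  congr 1
  ext i j
  rw [Matrix.mul_apply, Fin.sum_univ_succ]
  refine Fin.cases ?_ (fun i => ?_) i
  · rw [Matrix.of_apply, Fin.cons_zero, cast_add_choose_eq, ← Fin.sum_univ_eq_sum_range
      (fun s => (c.choose (l + 1 + s) : ℚ) * (Y j).choose (b - 1 - s)), add_comm]
    simp [hA, hB]
  · rw [Matrix.of_apply, Fin.cons_succ, cast_add_choose_sub_eq _ _ _ _ i.2,
      ← Fin.sum_univ_eq_sum_range
      (fun s => if (i : ℕ) ≤ s then (c.choose (s - i) : ℚ) * (Y j).choose (b - 1 - s) else 0)]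
    simp [hA, hB]

lemma M_hexDentB_eq (hl : l ≤ c + k) : (M (HexDentB a b c k l) : ℚ) =
    (a + c + k - l).factorial * (b + l).factorial / (a.factorial * (b + c + k).factorial) *
      (∏ j ∈ range b, ((a + c + k + 1 + j).factorial * j.factorial : ℚ) /
        ((a + k + 1 + j).factorial * (c + j).factorial)) * binomialSum b c k l := by
  set X : Fin (b + 1) → ℕ := Fin.cons a fun j : Fin b => a + k + 1 + j with hX
  set Y : Fin (b + 1) → ℕ := Fin.cons (b + k) fun j : Fin b => b - 1 - (j : ℕ) with hY
  set s : Fin (b + 1) → ℕ := Fin.cons (b + l) fun i : Fin b => b - 1 - (i : ℕ) with hs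
  set T := a + b + c + k with hT
  have hXY : ∀ j, X j + (c + Y j) = T := fun j => by
    refine Fin.cases ?_ (fun j => ?_) j
    · simp only [hX, hY, Fin.cons_zero]
      omega
    · have := j.2
      simp only [hX, hY, Fin.cons_succ]
      omega
  have hsT : ∀ i, s i ≤ T := fun i => by
    refine Fin.cases ?_ (fun i => ?_) i
    · simp only [hs, Fin.cons_zero]
      omega
    · simp only [hs, Fin.cons_succ]
      omega
  have hM : (Matrix.of (Fin.cons (pathRow a b k (a + c + k - l) 0)
      fun i : Fin b => pathRow a b k (a + c + k + 1 + i) 0)) =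
      Matrix.of fun i j => (((T - s i).factorial * (s i).factorial : ℚ)) *
        Matrix.of (fun i j => ((X j).factorial * (c + Y j).factorial : ℚ)⁻¹ *
          Matrix.of (fun i j => ((c + Y j).choose (s i) : ℚ)) i j) i j := by
    ext i j
    simp only [Matrix.of_apply]
    rw [← hXY j, ← choose_sub_eq _ _ _ (by rw [hXY]; exact hsT i), hXY]
    refine Fin.cases ?_ (fun i => ?_) i
    · rw [Fin.cons_zero, pathRow_zero]
      simp only [hs, Fin.cons_zero]
      rw [show T - (b + l) = a + c + k - l by omega]
    · have := i.2
      rw [Fin.cons_succ, pathRow_zero]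
      simp only [hs, Fin.cons_succ]
      rw [show T - (b - 1 - i) = a + c + k + 1 + i by omega]
  rw [M_hexDentB_eq_det hl, det_pathRow_eq, hM, Matrix.det_mul_column, Matrix.det_mul_row,
    det_choose_eq_binomialSum, ← mul_assoc]
  congr 1
  rw [Fin.prod_univ_succ, Fin.prod_univ_succ]
  simp only [hs, hX, hY, Fin.cons_zero, Fin.cons_succ]
  rw [Fin.prod_univ_eq_prod_range
      fun i => ((T - (b - 1 - i)).factorial * (b - 1 - i).factorial : ℚ),
    Fin.prod_univ_eq_prod_range
      fun j => ((a + k + 1 + j).factorial * (c + (b - 1 - j)).factorial : ℚ)⁻¹]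
  simp only [prod_inv_distrib, prod_mul_distrib, prod_div_distrib]
  rw [prod_range_reflect (fun i => (i.factorial : ℚ)),
    prod_range_reflect (fun i => ((c + i).factorial : ℚ)),
    prod_congr rfl fun i hi => show ((T - (b - 1 - i)).factorial : ℚ) =
      (a + c + k + 1 + i).factorial by
        have := mem_range.1 hi
        congr 2
        omega,
    show T - (b + l) = a + c + k - l by omega, show c + (b + k) = b + c + k by ring]
  field_simp

end Determinant

/-- Proposition 4.2(b): `M(H'_{a,b,c}(k,l)) = C(a+k,k) · q(c,l)/q(0,0)`. -/
theorem hexagon_two_dents_b (a b c k l : ℕ) (hl : l ≤ c + k) :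
    (M (HexDentB a b c k l) : ℚ) =
      ((a + k).choose k : ℚ) * qPoly a b k (c : ℚ) (l : ℚ) / qPoly a b k 0 0 := by
  have h0 := qPoly_eq a b 0 k 0 (Nat.zero_le _)
  have hbin : binomialSum b 0 k 0 = (b + k).factorial / (b.factorial * k.factorial) := by
    rw [binomialSum, Finset.sum_range_one, Nat.choose_self, Nat.cast_one, one_mul, add_zero,
      Nat.cast_choose ℚ (Nat.le_add_right b k), Nat.add_sub_cancel_left]
  rw [hbin, Nat.cast_zero] at h0
  rw [M_hexDentB_eq hl, qPoly_eq a b c k l hl, h0, Nat.cast_choose ℚ (Nat.le_add_left k a),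
    Nat.add_sub_cancel, show a + c + k - l = a + (c + k - l) by omega]
  simp only [Finset.prod_div_distrib, Finset.prod_mul_distrib, add_zero, zero_add, Nat.sub_zero]
  have h1 : (∏ j ∈ Finset.range b, ((c + j).factorial : ℚ)) ≠ 0 :=
    Finset.prod_ne_zero_iff.2 fun j _ => by positivity
  have h2 : (∏ j ∈ Finset.range b, ((a + k + 1 + j).factorial : ℚ)) ≠ 0 :=
    Finset.prod_ne_zero_iff.2 fun j _ => by positivity
  have h3 : (∏ j ∈ Finset.range b, (j.factorial : ℚ)) ≠ 0 :=
    Finset.prod_ne_zero_iff.2 fun j _ => by positivity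
  field_simp
end
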